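/- Let Q be a finite acyclic quiver, B = kQ its path algebra, and let U be a basic partial silting object in D_fd(B). Then U is a maximal partial silting object if and only if U generates per B (i.e. thick(U) = per B). -/

import Mathlib

/-!
Formalization of a statement from:
L. Guo, "Almost complete cluster tilting objects in generalized higher
cluster categories".

Since dg algebras, their derived categories and the accompanying homological
machinery are not available in Mathlib, the ambient setting is axiomatized:
the derived category `D(A)` is modelled as an abstract (pre)triangulated
`k`-linear category, and the dg algebra and its homological properties are
recorded through the structures below, whose fields correspond exactly to the
hypotheses occurring in the paper.
-/

open CategoryTheory CategoryTheory.Limits CategoryTheory.Pretriangulated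

universe v u

namespace HigherCluster

section Additive

variable {C : Type u} [Category.{v} C] [Preadditive C] [HasZeroObject C]
  [HasBinaryBiproducts C]

/-- `AddOf M X` means that `X` belongs to `add M`, the smallest full subcategory
containing `M` that is closed under finite direct sums, direct summands and
isomorphisms. -/
inductive AddOf (M : C) : C → Prop
  | base : AddOf M M
  | zero (Z : C) (hZ : IsZero Z) : AddOf M Z
  | biprod {X Y : C} : AddOf M X → AddOf M Y → AddOf M (X ⊞ Y)
  | ofIso {X Y : C} (e : X ≅ Y) : AddOf M X → AddOf M Y
  | summandLeft {X Y : C} : AddOf M (X ⊞ Y) → AddOf M X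
  | summandRight {X Y : C} : AddOf M (X ⊞ Y) → AddOf M Y

/-- An object is indecomposable if it is nonzero and, in any direct sum
decomposition, one of the two summands vanishes. -/
def Indec (X : C) : Prop :=
  ¬ IsZero X ∧ ∀ Y Z : C, Nonempty (X ≅ Y ⊞ Z) → IsZero Y ∨ IsZero Z

/-- An object is basic if it has no repeated (nonzero) direct summand. -/
def IsBasic (Z : C) : Prop :=
  ∀ X W : C, Nonempty (Z ≅ (X ⊞ X) ⊞ W) → IsZero X

/-- `f : B ⟶ X` is a minimal right `add M`-approximation of `X`. -/
structure IsMinRightApprox (M : C) {B X : C} (f : B ⟶ X) : Prop where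
  mem : AddOf M B
  fac : ∀ {B' : C}, AddOf M B' → ∀ g : B' ⟶ X, ∃ h : B' ⟶ B, h ≫ f = g
  minimal : ∀ h : B ⟶ B, h ≫ f = f → IsIso h

/-- `g : X ⟶ B` is a minimal left `add M`-approximation of `X`. -/
structure IsMinLeftApprox (M : C) {X B : C} (g : X ⟶ B) : Prop where
  mem : AddOf M B
  fac : ∀ {B' : C}, AddOf M B' → ∀ g' : X ⟶ B', ∃ h : B ⟶ B', g ≫ h = g'
  minimal : ∀ h : B ⟶ B, g ≫ h = g → IsIso h

end Additive

section Triangulated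

variable (D : Type u) [Category.{v} D] [Preadditive D] [HasZeroObject D]
  [HasShift D ℤ] [∀ n : ℤ, (shiftFunctor D n).Additive] [Pretriangulated D]
  [HasBinaryBiproducts D]

/-- `IsThickOf G X` : the object `X` lies in `thick G`, the smallest thick
subcategory (triangulated and closed under direct summands) containing `G`. -/
inductive IsThickOf (G : D) : D → Prop
  | base : IsThickOf G G
  | zero (Z : D) (hZ : IsZero Z) : IsThickOf G Z
  | shift (X : D) (n : ℤ) : IsThickOf G X → IsThickOf G (X⟦n⟧)
  | ofIso {X Y : D} (e : X ≅ Y) : IsThickOf G X → IsThickOf G Y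
  | ext {T : Triangle D} (hT : T ∈ distTriang D) :
      IsThickOf G T.obj₁ → IsThickOf G T.obj₃ → IsThickOf G T.obj₂
  | summandLeft {X Y : D} : IsThickOf G (X ⊞ Y) → IsThickOf G X
  | summandRight {X Y : D} : IsThickOf G (X ⊞ Y) → IsThickOf G Y

/-- `Z` is a silting object of the triangulated category `per` (modelled as a
subset of the ambient derived category `D`): `Z ∈ per`, `thick Z = per`, and
`Hom(Z, Σ^i Z) = 0` for all integers `i > 0`. -/
def IsSiltingFor (per : Set D) (Z : D) : Prop :=
  Z ∈ per ∧ (∀ X ∈ per, IsThickOf D Z X) ∧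
    ∀ i : ℤ, 0 < i → ∀ f : Z ⟶ Z⟦i⟧, f = 0

/-- `Z` is a tilting object of `per`: `Z ∈ per`, `thick Z = per`, and
`Hom(Z, Σ^i Z) = 0` for all integers `i ≠ 0`. -/
def IsTiltingFor (per : Set D) (Z : D) : Prop :=
  Z ∈ per ∧ (∀ X ∈ per, IsThickOf D Z X) ∧
    ∀ i : ℤ, i ≠ 0 → ∀ f : Z ⟶ Z⟦i⟧, f = 0

end Triangulated

section Quivers

/-- A finite graded quiver. -/
structure GradedQuiver : Type (u + 1) where
  /-- vertices -/
  V : Type u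
  [fintV : Fintype V]
  [decV : DecidableEq V]
  /-- arrows -/
  Arr : Type u
  [fintA : Fintype Arr]
  [decA : DecidableEq Arr]
  src : Arr → V
  tgt : Arr → V
  deg : Arr → ℤ

attribute [instance] GradedQuiver.fintV GradedQuiver.decV GradedQuiver.fintA
  GradedQuiver.decA

/-- The double quiver `Q̄` obtained by adjoining to each arrow `a` of `Q` an
opposite arrow `a*` of degree `-m - |a|`. -/
def GradedQuiver.double (Q : GradedQuiver.{u}) (m : ℕ) : GradedQuiver.{u} where
  V := Q.V
  Arr := Q.Arr ⊕ Q.Arr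
  src := Sum.elim Q.src Q.tgt
  tgt := Sum.elim Q.tgt Q.src
  deg := Sum.elim Q.deg fun a => -(m : ℤ) - Q.deg a

/-- A (nonempty) path in a graded quiver: a composable sequence of arrows. -/
structure QPath (Q : GradedQuiver.{u}) : Type u where
  len : ℕ
  len_pos : 0 < len
  arr : Fin len → Q.Arr
  comp : ∀ (i : ℕ) (h : i + 1 < len),
    Q.src (arr ⟨i + 1, h⟩) = Q.tgt (arr ⟨i, Nat.lt_of_succ_lt h⟩)

/-- The (total) degree of a path. -/
def QPath.degree {Q : GradedQuiver.{u}} (p : QPath Q) : ℤ :=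
  ∑ i, Q.deg (p.arr i)

/-- A path is closed (cyclic) if its target coincides with its source. -/
def QPath.IsClosed {Q : GradedQuiver.{u}} (p : QPath Q) : Prop :=
  Q.tgt (p.arr ⟨p.len - 1, Nat.sub_lt p.len_pos Nat.one_pos⟩) =
    Q.src (p.arr ⟨0, p.len_pos⟩)

/-- A superpotential on a graded quiver, recorded through its coefficients:
`W p` is the coefficient of the path `p` in `W`.  It is *good* (reduced, of
degree `1 - m` and of length `≥ 3`) if every path occurring in it is closed,
of degree `1 - m` and of length at least `3`. -/
def IsGoodPotential (Q : GradedQuiver.{u}) (m : ℕ) (k : Type u) [Field k]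
    (W : QPath Q → k) : Prop :=
  ∀ p : QPath Q, W p ≠ 0 → p.IsClosed ∧ p.degree = 1 - (m : ℤ) ∧ 3 ≤ p.len

/-- The graded quiver `Q` is concentrated in degrees `[-m/2, 0]`. -/
def GradedQuiver.GoodDegrees (Q : GradedQuiver.{u}) (m : ℕ) : Prop :=
  ∀ a : Q.Arr, -(m : ℤ) ≤ 2 * Q.deg a ∧ Q.deg a ≤ 0

/-- there are no loops of `Q` at the vertex `i` -/
def GradedQuiver.NoLoopsAt (Q : GradedQuiver.{u}) (i : Q.V) : Prop :=
  ∀ a : Q.Arr, ¬ (Q.src a = i ∧ Q.tgt a = i)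

/-- `Q` is acyclic: it admits a grading of its vertices which is strictly
increased by every arrow (equivalently, `Q` has no oriented cycles). -/
def GradedQuiver.Acyclic (Q : GradedQuiver.{u}) : Prop :=
  ∃ h : Q.V → ℕ, ∀ a : Q.Arr, h (Q.src a) < h (Q.tgt a)

/-- Arrows of the double quiver `Q̄` with target `i` and degree `-j` (the extra
loops `t_i` of degree `-m-1` of the extended quiver `Q̃` are treated
separately). -/
def ArrInto (Q : GradedQuiver.{u}) (m : ℕ) (i : Q.V) (j : ℕ) : Type u :=
  {ρ : Q.Arr ⊕ Q.Arr // (Q.double m).tgt ρ = i ∧ (Q.double m).deg ρ = -(j : ℤ)}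

noncomputable instance (Q : GradedQuiver.{u}) (m : ℕ) (i : Q.V) (j : ℕ) :
    Fintype (ArrInto Q m i j) := by
  classical exact Subtype.fintype _

end Quivers

universe w

section Thick

set_option linter.unusedSectionVars false

variable {D : Type u} [Category.{v} D] [Preadditive D] [HasZeroObject D]
  [HasShift D ℤ] [∀ n : ℤ, (shiftFunctor D n).Additive] [Pretriangulated D]
  [HasBinaryBiproducts D]

/-- `Hom(X, Σⁿ Y)` vanishes. -/
def Van (X Y : D) (n : ℤ) : Prop := ∀ f : X ⟶ Y⟦n⟧, f = 0

/-- `Hom(X, Y)` vanishes. -/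
def NoHom (X Y : D) : Prop := ∀ f : X ⟶ Y, f = 0

/-- All graded morphisms from `X` to `Y` vanish. -/
def Orth (X Y : D) : Prop := ∀ n, Van X Y n

lemma NoHom.of_retract_left {X X' Y : D} (h : NoHom X Y) (i : X' ⟶ X) (r : X ⟶ X')
    (hir : i ≫ r = 𝟙 X') : NoHom X' Y := fun f => by
  rw [← Category.id_comp f, ← hir, Category.assoc, h (r ≫ f), comp_zero]

lemma NoHom.of_retract_right {X Y Y' : D} (h : NoHom X Y) (i : Y' ⟶ Y) (r : Y ⟶ Y')
    (hir : i ≫ r = 𝟙 Y') : NoHom X Y' := fun f => by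
  rw [← Category.comp_id f, ← hir, ← Category.assoc, h (f ≫ i), zero_comp]

lemma noHom_iso_left {X X' Y : D} (e : X ≅ X') : NoHom X Y ↔ NoHom X' Y :=
  ⟨fun h => h.of_retract_left e.inv e.hom (by simp),
    fun h => h.of_retract_left e.hom e.inv (by simp)⟩

lemma noHom_iso_right {X Y Y' : D} (e : Y ≅ Y') : NoHom X Y ↔ NoHom X Y' :=
  ⟨fun h => h.of_retract_right e.inv e.hom (by simp),
    fun h => h.of_retract_right e.hom e.inv (by simp)⟩

lemma Van.of_retract_left {X X' Y : D} {n : ℤ} (h : Van X Y n) (i : X' ⟶ X) (r : X ⟶ X')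
    (hir : i ≫ r = 𝟙 X') : Van X' Y n := NoHom.of_retract_left h i r hir

lemma Van.of_retract_right {X Y Y' : D} {n : ℤ} (h : Van X Y n) (i : Y' ⟶ Y) (r : Y ⟶ Y')
    (hir : i ≫ r = 𝟙 Y') : Van X Y' n :=
  NoHom.of_retract_right h (i⟦n⟧') (r⟦n⟧') (by rw [← Functor.map_comp, hir,
      CategoryTheory.Functor.map_id])

lemma van_iso_left {X X' Y : D} {n : ℤ} (e : X ≅ X') : Van X Y n ↔ Van X' Y n :=
  noHom_iso_left e

lemma van_iso_right {X Y Y' : D} {n : ℤ} (e : Y ≅ Y') : Van X Y n ↔ Van X Y' n :=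
  noHom_iso_right ((shiftFunctor D n).mapIso e)

lemma noHom_shift {X Y : D} (a : ℤ) : NoHom (X⟦a⟧) (Y⟦a⟧) ↔ NoHom X Y := by
  constructor
  · intro h f
    exact (shiftFunctor D a).map_injective (by rw [h (f⟦a⟧'), Functor.map_zero])
  · intro h f
    obtain ⟨g, rfl⟩ := (shiftFunctor D a).map_surjective f
    rw [h g, Functor.map_zero]

lemma van_zero {X Y : D} : Van X Y 0 ↔ NoHom X Y :=
  noHom_iso_right ((shiftFunctorZero D ℤ).app Y)

lemma van_shift_right {X Y : D} (b n : ℤ) : Van X (Y⟦b⟧) n ↔ Van X Y (b + n) :=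
  noHom_iso_right ((shiftFunctorAdd D b n).app Y).symm

lemma van_shift_left {X Y : D} (a n : ℤ) : Van (X⟦a⟧) Y n ↔ Van X Y (n - a) := by
  refine Iff.trans ?_ (noHom_shift (X := X) (Y := Y⟦n - a⟧) a)
  exact noHom_iso_right ((shiftFunctorAdd' D (n - a) a n (by ring)).app Y)

lemma noHom_shift_left {X Y : D} (a : ℤ) : NoHom (X⟦a⟧) Y ↔ Van X Y (-a) := by
  rw [← van_zero, van_shift_left, zero_sub]

lemma orth_shift_right {X Y : D} (b : ℤ) : Orth X (Y⟦b⟧) ↔ Orth X Y :=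
  ⟨fun h n => by simpa using (van_shift_right b (n - b)).1 (h _),
    fun h n => (van_shift_right b n).2 (h _)⟩

lemma orth_shift_left {X Y : D} (b : ℤ) : Orth (X⟦b⟧) Y ↔ Orth X Y :=
  ⟨fun h n => by simpa using (van_shift_left b (n + b)).1 (h _),
    fun h n => (van_shift_left b n).2 (h _)⟩

lemma van_of_isZero_left {X Y : D} (h : IsZero X) (n : ℤ) : Van X Y n := fun f => h.eq_of_src f 0

lemma isZero_shift {Y : D} (h : IsZero Y) (n : ℤ) : IsZero (Y⟦n⟧) :=
  (shiftFunctor D n).map_isZero h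

lemma isZero_shift_iff {Y : D} (n : ℤ) : IsZero (Y⟦n⟧) ↔ IsZero Y :=
  ⟨fun h => (isZero_shift h (-n)).of_iso ((shiftShiftNeg Y n)).symm, fun h => isZero_shift h n⟩

lemma van_of_isZero_right {X Y : D} (h : IsZero Y) (n : ℤ) : Van X Y n :=
  fun f => (isZero_shift h n).eq_of_tgt f 0

lemma isZero_of_van {X : D} (h : Van X X 0) : IsZero X :=
  (IsZero.iff_id_eq_zero X).2 (van_zero.1 h _)

lemma isZero_of_orth {X : D} (h : Orth X X) : IsZero X := isZero_of_van (h 0)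

lemma van_biprod_right {X Y Z : D} {n : ℤ} (h : Van X Y n) (h' : Van X Z n) :
    Van X (Y ⊞ Z) n := fun f => by
  have e : 𝟙 (Y ⊞ Z) = biprod.fst ≫ biprod.inl + biprod.snd ≫ biprod.inr := biprod.total.symm
  have e' := congrArg (fun g => f ≫ g⟦n⟧') e
  simp only [CategoryTheory.Functor.map_id, Category.comp_id, Functor.map_add, Functor.map_comp,
    Preadditive.comp_add] at e'
  rw [e', ← Category.assoc, ← Category.assoc, h (f ≫ _), h' (f ≫ _), zero_comp, zero_comp, add_zero]

lemma van_biprod_left {X Y Z : D} {n : ℤ} (h : Van X Z n) (h' : Van Y Z n) :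
    Van (X ⊞ Y) Z n := fun f => by
  apply biprod.hom_ext'
  · rw [h (_ ≫ f), comp_zero]
  · rw [h' (_ ≫ f), comp_zero]

section LES

variable {A M C : D} {f : A ⟶ M} {g : M ⟶ C} {h : C ⟶ A⟦(1 : ℤ)⟧}
  (hT : Triangle.mk f g h ∈ distTriang D)
include hT

/-- The long exact covariant sequence, middle term. -/
lemma van_tri₂ {Y : D} {n : ℤ} (h₁ : Van Y A n) (h₃ : Van Y C n) : Van Y M n := fun x => by
  have hS := Triangle.shift_distinguished _ hT n
  obtain ⟨y, hy⟩ := Triangle.coyoneda_exact₂ _ hS x (h₃ _)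
  have : y = 0 := h₁ y
  rw [hy, this]
  exact zero_comp

lemma van_tri₃ {Y : D} {n : ℤ} (h₂ : Van Y M n) (h₁ : Van Y A (n + 1)) : Van Y C n :=
  van_tri₂ (rot_of_distTriang _ hT) h₂ ((van_shift_right 1 n).2 (by rwa [add_comm]))

lemma van_tri₁ {Y : D} {n : ℤ} (h₃ : Van Y C (n - 1)) (h₂ : Van Y M n) : Van Y A n :=
  van_tri₂ (inv_rot_of_distTriang _ hT)
    ((van_shift_right (-1) n).2 (by rwa [neg_add_eq_sub])) h₂

lemma van_tri₂' {Y : D} {n : ℤ} (h₁ : Van A Y n) (h₃ : Van C Y n) : Van M Y n := fun x => by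
  obtain ⟨y, hy⟩ := Triangle.yoneda_exact₂ _ hT x (h₁ _)
  have : y = 0 := h₃ y
  rw [hy, this]
  exact comp_zero

lemma van_tri₃' {Y : D} {n : ℤ} (h₂ : Van M Y n) (h₁ : Van A Y (n - 1)) : Van C Y n :=
  van_tri₂' (rot_of_distTriang _ hT) h₂ ((van_shift_left 1 n).2 h₁)

lemma van_tri₁' {Y : D} {n : ℤ} (h₃ : Van C Y (n + 1)) (h₂ : Van M Y n) : Van A Y n :=
  van_tri₂' (inv_rot_of_distTriang _ hT) ((van_shift_left (-1) n).2 (by simpa using h₃)) h₂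

end LES

/-- A split monomorphism has a complement. -/
lemma exists_compl {X X' : D} (i : X' ⟶ X) (r : X ⟶ X') (hir : i ≫ r = 𝟙 X') :
    ∃ (W : D) (e : X ≅ X' ⊞ W), i ≫ e.hom = biprod.inl := by
  obtain ⟨W, p, w, hT⟩ := distinguished_cocone_triangle i
  have : w = 0 := by
    have h : w ≫ i⟦(1 : ℤ)⟧' = 0 := comp_distTriang_mor_zero₃₁ _ hT
    rw [← Category.comp_id w, ← CategoryTheory.Functor.map_id, ← hir, Functor.map_comp, ←
        Category.assoc, h,
      zero_comp]
  obtain ⟨e, he, -⟩ := exists_iso_binaryBiproduct_of_distTriang _ hT this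
  exact ⟨W, e, he⟩

/-- A predicate defining a thick subcategory. -/
structure Thick (T : D → Prop) : Prop where
  zero : ∀ {Z : D}, IsZero Z → T Z
  shift : ∀ {X : D}, T X → ∀ n : ℤ, T (X⟦n⟧)
  ext : ∀ {A M C : D} {f : A ⟶ M} {g : M ⟶ C} {h : C ⟶ A⟦(1 : ℤ)⟧},
    Triangle.mk f g h ∈ distTriang D → T A → T C → T M
  retract : ∀ {X X' : D} (i : X' ⟶ X) (r : X ⟶ X'), i ≫ r = 𝟙 X' → T X → T X'

namespace Thick

variable {T : D → Prop} (hT : Thick T)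
include hT

lemma iso {X Y : D} (e : X ≅ Y) (h : T X) : T Y := hT.retract e.inv e.hom (by simp) h

lemma shift_iff {X : D} (n : ℤ) : T (X⟦n⟧) ↔ T X :=
  ⟨fun h => hT.iso (shiftShiftNeg X n) (hT.shift h (-n)), fun h => hT.shift h n⟩

lemma ext₃ {A M C : D} {f : A ⟶ M} {g : M ⟶ C} {h : C ⟶ A⟦(1 : ℤ)⟧}
    (H : Triangle.mk f g h ∈ distTriang D) (h₁ : T A) (h₂ : T M) : T C :=
  hT.ext (rot_of_distTriang _ H) h₂ (hT.shift h₁ 1)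

lemma ext₁ {A M C : D} {f : A ⟶ M} {g : M ⟶ C} {h : C ⟶ A⟦(1 : ℤ)⟧}
    (H : Triangle.mk f g h ∈ distTriang D) (h₂ : T M) (h₃ : T C) : T A :=
  hT.ext (inv_rot_of_distTriang _ H) (hT.shift h₃ (-1)) h₂

lemma biprod {X Y : D} (hX : T X) (hY : T Y) : T (X ⊞ Y) :=
  hT.ext (binaryBiproductTriangle_distinguished X Y) hX hY

lemma fst {X Y : D} (h : T (X ⊞ Y)) : T X := hT.retract biprod.inl biprod.fst (by simp) h

lemma snd {X Y : D} (h : T (X ⊞ Y)) : T Y := hT.retract biprod.inr biprod.snd (by simp) h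

end Thick

lemma thick_isThickOf (G : D) : Thick (IsThickOf D G) where
  zero h := IsThickOf.zero _ h
  shift h n := IsThickOf.shift _ n h
  ext hT h₁ h₃ := IsThickOf.ext hT h₁ h₃
  retract i r hir h := by
    obtain ⟨W, e, -⟩ := exists_compl i r hir
    exact IsThickOf.summandLeft (IsThickOf.ofIso e h)

lemma thick_isThickOf_min {G : D} {T : D → Prop} (hT : Thick T) (hG : T G) {X : D}
    (h : IsThickOf D G X) : T X := by
  induction h with
  | base => exact hG
  | zero Z hZ => exact hT.zero hZ
  | shift X n _ ih => exact hT.shift ih n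
  | ofIso e _ ih => exact hT.iso e ih
  | ext H _ _ h₁ h₃ => exact hT.ext (f := _) (g := _) (h := _) H h₁ h₃
  | summandLeft _ ih => exact hT.fst ih
  | summandRight _ ih => exact hT.snd ih

/-- The right perpendicular subcategory of `X` in `T`. -/
def RPerp (T : D → Prop) (X : D) : D → Prop := fun Y => T Y ∧ Orth X Y

/-- The left perpendicular subcategory of `X` in `T`. -/
def LPerp (T : D → Prop) (X : D) : D → Prop := fun Y => T Y ∧ Orth Y X

lemma Thick.rPerp {T : D → Prop} (hT : Thick T) (X : D) : Thick (RPerp T X) where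
  zero h := ⟨hT.zero h, fun _ => van_of_isZero_right h _⟩
  shift h n := ⟨hT.shift h.1 n, (orth_shift_right n).2 h.2⟩
  ext H h₁ h₃ := ⟨hT.ext H h₁.1 h₃.1, fun n => van_tri₂ H (h₁.2 n) (h₃.2 n)⟩
  retract i r hir h := ⟨hT.retract i r hir h.1, fun n => (h.2 n).of_retract_right i r hir⟩

lemma Thick.lPerp {T : D → Prop} (hT : Thick T) (X : D) : Thick (LPerp T X) where
  zero h := ⟨hT.zero h, fun _ => van_of_isZero_left h _⟩
  shift h n := ⟨hT.shift h.1 n, (orth_shift_left n).2 h.2⟩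
  ext H h₁ h₃ := ⟨hT.ext H h₁.1 h₃.1, fun n => van_tri₂' H (h₁.2 n) (h₃.2 n)⟩
  retract i r hir h := ⟨hT.retract i r hir h.1, fun n => (h.2 n).of_retract_left i r hir⟩

/-- The triangle `A → M → C → A⟦1⟧` on a morphism `A ⟶ M`. -/
lemma exists_cone {A M : D} (f : A ⟶ M) : ∃ (C : D) (g : M ⟶ C) (h : C ⟶ A⟦(1 : ℤ)⟧),
    Triangle.mk f g h ∈ distTriang D := distinguished_cocone_triangle f

lemma exists_fiber {M C : D} (g : M ⟶ C) : ∃ (A : D) (f : A ⟶ M) (h : C ⟶ A⟦(1 : ℤ)⟧),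
    Triangle.mk f g h ∈ distTriang D := distinguished_cocone_triangle₁ g

/-- Finite length of `Hom(X, Y)`. -/
def FinHom (R : Type w) [Ring R] [Linear R D] (X Y : D) : Prop := IsFiniteLength R (X ⟶ Y)

section FiniteLength

variable (R : Type w) [Ring R] [Linear R D]

lemma isFiniteLength_of_range_eq_ker {M N P : Type*} [AddCommGroup M] [AddCommGroup N]
    [AddCommGroup P] [Module R M] [Module R N] [Module R P] (f : M →ₗ[R] N) (g : N →ₗ[R] P)
    (h : LinearMap.range f = LinearMap.ker g) (hM : IsFiniteLength R M)
    (hP : IsFiniteLength R P) : IsFiniteLength R N := by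
  rw [isFiniteLength_iff_isNoetherian_isArtinian] at *
  obtain ⟨h₁, h₂⟩ := hM
  obtain ⟨h₃, h₄⟩ := hP
  exact ⟨isNoetherian_of_range_eq_ker f g h, isArtinian_of_range_eq_ker f g h⟩

variable {R}

lemma finHom_retract_left {X X' Y : D} (i : X' ⟶ X) (r : X ⟶ X') (hir : i ≫ r = 𝟙 X')
    (h : FinHom R X Y) : FinHom R X' Y :=
  IsFiniteLength.of_injective h (f := Linear.leftComp R Y r) fun f g hfg => by
    have : r ≫ f = r ≫ g := hfg
    rw [← Category.id_comp f, ← Category.id_comp g, ← hir, Category.assoc, this, Category.assoc]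

lemma finHom_retract_right {X Y Y' : D} (i : Y' ⟶ Y) (r : Y ⟶ Y') (hir : i ≫ r = 𝟙 Y')
    (h : FinHom R X Y) : FinHom R X Y' :=
  IsFiniteLength.of_injective h (f := Linear.rightComp R X i) fun f g hfg => by
    have : f ≫ i = g ≫ i := hfg
    rw [← Category.comp_id f, ← Category.comp_id g, ← hir, ← Category.assoc, this, Category.assoc]

lemma finHom_of_noHom {X Y : D} (h : NoHom X Y) : FinHom R X Y :=
  haveI : Subsingleton (X ⟶ Y) := ⟨fun f g => by rw [h f, h g]⟩
  IsFiniteLength.of_subsingleton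

lemma finHom_triangle (T : Triangle D) (hT : T ∈ distTriang D) {Y : D}
    (h₁ : FinHom R Y T.obj₁) (h₃ : FinHom R Y T.obj₃) : FinHom R Y T.obj₂ := by
  refine isFiniteLength_of_range_eq_ker R
    (Linear.rightComp R Y T.mor₁) (Linear.rightComp R Y T.mor₂) ?_ h₁ h₃
  ext x
  constructor
  · rintro ⟨y, rfl⟩
    simp [comp_distTriang_mor_zero₁₂ _ hT]
  · intro hx
    obtain ⟨y, hy⟩ := Triangle.coyoneda_exact₂ _ hT x hx
    exact ⟨y, hy.symm⟩

lemma finHom_triangle' (T : Triangle D) (hT : T ∈ distTriang D) {Y : D}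
    (h₁ : FinHom R T.obj₁ Y) (h₃ : FinHom R T.obj₃ Y) : FinHom R T.obj₂ Y := by
  refine isFiniteLength_of_range_eq_ker R
    (Linear.leftComp R Y T.mor₂) (Linear.leftComp R Y T.mor₁) ?_ h₃ h₁
  ext x
  constructor
  · rintro ⟨y, rfl⟩
    simp [comp_distTriang_mor_zero₁₂_assoc _ hT]
  · intro hx
    obtain ⟨y, hy⟩ := Triangle.yoneda_exact₂ _ hT x hx
    exact ⟨y, hy.symm⟩

lemma thick_finHom_right (X : D) : Thick fun Y => ∀ n : ℤ, FinHom R X (Y⟦n⟧) where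
  zero h n := finHom_of_noHom fun f => (isZero_shift h n).eq_of_tgt _ _
  shift {Y} h m n := finHom_retract_right ((shiftFunctorAdd D m n).app Y).inv
    ((shiftFunctorAdd D m n).app Y).hom (by simp) (h (m + n))
  ext hT h₁ h₃ n := finHom_triangle _ (Triangle.shift_distinguished _ hT n) (h₁ n) (h₃ n)
  retract i r hir h n := finHom_retract_right (i⟦n⟧') (r⟦n⟧')
    (by rw [← CategoryTheory.Functor.map_comp, hir, CategoryTheory.Functor.map_id]) (h n)

end FiniteLength

section Center

variable (D) in
/-- The center of `D`, as a ring acting on all groups of morphisms. -/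
def CenterRing : Type (max u v) := CatCenter D

noncomputable instance : Ring (CenterRing D) := inferInstanceAs (Ring (CatCenter D))

noncomputable instance : Linear (CenterRing D) D :=
  Linear.ofRingMorphism (RingHom.id (CatCenter D))

lemma centerRing_smul {X Y : D} (p : CatCenter D) (f : X ⟶ Y) :
    (show CenterRing D from p) • f = p.app X ≫ f := rfl

lemma centerRing_smul' {X Y : D} (p : CatCenter D) (f : X ⟶ Y) :
    (show CenterRing D from p) • f = f ≫ p.app Y := (p.naturality f).symm

/-- The natural isomorphism between an object and its double shift. -/
noncomputable def unshift (n : ℤ) (X : D) : X⟦-n⟧⟦n⟧ ≅ X :=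
  (shiftFunctorCompIsoId D (-n) n (by simp)).app X

lemma unshift_naturality (n : ℤ) {X Y : D} (f : X ⟶ Y) :
    f⟦-n⟧'⟦n⟧' ≫ (unshift n Y).hom = (unshift n X).hom ≫ f :=
  (shiftFunctorCompIsoId D (-n) n (by simp)).hom.naturality f

/-- Conjugation of an element of the center by a shift functor. -/
noncomputable def centerConj (n : ℤ) (p : CatCenter D) : CatCenter D where
  app X := (unshift n X).inv ≫ (p.app (X⟦-n⟧))⟦n⟧' ≫ (unshift n X).hom
  naturality X Y f := by
    have h := unshift_naturality n f
    have hp := congrArg (fun g => g⟦n⟧') (p.naturality (f⟦-n⟧'))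
    simp only [Functor.map_comp] at hp
    rw [← cancel_epi (unshift n X).hom]
    change (unshift n X).hom ≫ f ≫ (unshift n Y).inv ≫ (p.app (Y⟦-n⟧))⟦n⟧' ≫ (unshift n Y).hom =
      (unshift n X).hom ≫ ((unshift n X).inv ≫ (p.app (X⟦-n⟧))⟦n⟧' ≫ (unshift n X).hom) ≫ f
    simp only [Category.assoc, Iso.hom_inv_id_assoc]
    rw [← h, ← reassoc_of% unshift_naturality n f, Iso.hom_inv_id_assoc]
    rw [← Category.assoc, ← Category.assoc]
    exact congrArg (· ≫ (unshift n Y).hom) hp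

lemma finHom_of_field {k : Type*} [Field k] [Linear k D] {X Y : D} (h : FinHom k X Y) :
    FinHom (CenterRing D) X Y := by
  unfold FinHom at *
  rw [isFiniteLength_iff_isNoetherian_isArtinian] at *
  obtain ⟨h₁, h₂⟩ := h
  let φ : Submodule (CenterRing D) (X ⟶ Y) → Submodule k (X ⟶ Y) := fun N =>
    { N.toAddSubmonoid with
      smul_mem' := fun a f hf => by
        have := N.smul_mem (Linear.toCatCenter k D a) hf
        erw [centerRing_smul (Linear.toCatCenter k D a) f] at this
        simpa using this }
  have hφ : StrictMono φ := fun N N' h => lt_of_le_of_ne (fun x hx => h.le hx)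
    fun he => h.ne (SetLike.ext fun x => SetLike.ext_iff.1 he x)
  exact ⟨isNoetherian_iff'.2 hφ.wellFoundedGT, hφ.wellFoundedLT⟩

lemma finHom_shift {X Y : D} (n : ℤ) (h : FinHom (CenterRing D) X (Y⟦-n⟧)) :
    FinHom (CenterRing D) (X⟦n⟧) Y := by
  unfold FinHom at *
  rw [isFiniteLength_iff_isNoetherian_isArtinian] at *
  obtain ⟨h₁, h₂⟩ := h
  let φ : Submodule (CenterRing D) (X⟦n⟧ ⟶ Y) → Submodule (CenterRing D) (X ⟶ Y⟦-n⟧) := fun N =>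
    { carrier := {g | g⟦n⟧' ≫ (unshift n Y).hom ∈ N}
      zero_mem' := by simp
      add_mem' := fun {a b} ha hb => by
        simp only [Set.mem_ofPred_eq, Functor.map_add, Preadditive.add_comp] at ha hb ⊢
        exact N.add_mem ha hb
      smul_mem' := fun p g hg => by
        have h := N.smul_mem (centerConj n p) hg
        erw [centerRing_smul' (centerConj n p)] at h
        simp only [Set.mem_ofPred_eq]
        erw [centerRing_smul' p g]
        rw [Functor.map_comp, Category.assoc]
        change (g⟦n⟧' ≫ (unshift n Y).hom) ≫ (unshift n Y).inv ≫ _ ∈ N at h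
        simpa [centerConj] using h }
  have hφ : StrictMono φ := fun N N' h => lt_of_le_of_ne (fun x hx => h.le hx)
    fun he => h.ne (SetLike.ext fun x => by
      obtain ⟨g, hg⟩ := (shiftFunctor D n).map_surjective (x ≫ (unshift n Y).inv)
      have := SetLike.ext_iff.1 he g
      have hx : g⟦n⟧' ≫ (unshift n Y).hom = x := by rw [hg]; simp
      change g⟦n⟧' ≫ (unshift n Y).hom ∈ N ↔ g⟦n⟧' ≫ (unshift n Y).hom ∈ N' at this
      rwa [hx] at this)
  exact ⟨isNoetherian_iff'.2 hφ.wellFoundedGT, hφ.wellFoundedLT⟩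

lemma thick_finHom_left {T : D → Prop} (hT : Thick T) :
    Thick fun X => ∀ Y, T Y → FinHom (CenterRing D) X Y where
  zero h _ _ := finHom_of_noHom fun _ => h.eq_of_src _ _
  shift h n _ hY := finHom_shift n (h _ (hT.shift hY _))
  ext hT h₁ h₃ Y hY := finHom_triangle' _ hT (h₁ Y hY) (h₃ Y hY)
  retract i r hir h Y hY := finHom_retract_left i r hir (h Y hY)

end Center

lemma thick_bdd_right (X : D) : Thick fun Y => ∃ N : ℤ, ∀ n, N < |n| → Van X Y n where
  zero h := ⟨0, fun n _ => van_of_isZero_right h n⟩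
  shift {Y} := fun ⟨N, h⟩ m => ⟨N + |m|, fun n hn => (van_shift_right m n).2 (h _ (by
    have := abs_sub_abs_le_abs_sub n (-m)
    rw [sub_neg_eq_add, abs_neg, add_comm n] at this
    linarith))⟩
  ext hT := fun ⟨N, h₁⟩ ⟨N', h₃⟩ => ⟨max N N', fun n hn => van_tri₂ hT
    (h₁ n ((le_max_left _ _).trans_lt hn)) (h₃ n ((le_max_right _ _).trans_lt hn))⟩
  retract i r hir := fun ⟨N, h⟩ => ⟨N, fun n hn => (h n hn).of_retract_right i r hir⟩

lemma thick_bdd_left (T : D → Prop) :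
    Thick fun X => ∀ Y, T Y → ∃ N : ℤ, ∀ n, N < |n| → Van X Y n where
  zero h Y _ := ⟨0, fun n _ => van_of_isZero_left h n⟩
  shift {X} h m Y hY := by
    obtain ⟨N, h⟩ := h Y hY
    exact ⟨N + |m|, fun n hn => (van_shift_left m n).2 (h _ (by
      have := abs_sub_abs_le_abs_sub n m
      linarith))⟩
  ext hT h₁ h₃ Y hY := by
    obtain ⟨N, h₁⟩ := h₁ Y hY
    obtain ⟨N', h₃⟩ := h₃ Y hY
    exact ⟨max N N', fun n hn => van_tri₂' hT
      (h₁ n ((le_max_left _ _).trans_lt hn)) (h₃ n ((le_max_right _ _).trans_lt hn))⟩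
  retract i r hir h Y hY := by
    obtain ⟨N, h⟩ := h Y hY
    exact ⟨N, fun n hn => (h n hn).of_retract_left i r hir⟩

/-- The closure of a class of objects under finite direct sums and retracts. -/
inductive Heart (S : D → Prop) : D → Prop
  | base {X : D} : S X → Heart S X
  | zero {Z : D} : IsZero Z → Heart S Z
  | biprod {X Y : D} : Heart S X → Heart S Y → Heart S (X ⊞ Y)
  | retract {X X' : D} (i : X' ⟶ X) (r : X ⟶ X') (hir : i ≫ r = 𝟙 X') : Heart S X → Heart S X'

open scoped ZeroObject in
/-- The direct sum of a list of shifted objects. -/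
noncomputable def sumList : List (D × ℤ) → D
  | [] => 0
  | p :: l => p.1⟦p.2⟧ ⊞ sumList l

lemma isZero_sumList_nil : IsZero (sumList ([] : List (D × ℤ))) := isZero_zero D

/-- A thick subcategory with finite length graded morphism spaces of bounded support, all of
whose objects are sums of shifts of objects of a hereditary heart `H`. -/
structure Setup (R : Type w) [Ring R] [Linear R D] (T₀ H : D → Prop) : Prop where
  thick : Thick T₀
  fin : ∀ {X Y : D}, T₀ X → T₀ Y → IsFiniteLength R (X ⟶ Y)
  bdd : ∀ {X Y : D}, T₀ X → T₀ Y → ∃ N : ℤ, ∀ n, N < |n| → Van X Y n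
  H_le : ∀ {X : D}, H X → T₀ X
  H_zero : ∀ {X : D}, IsZero X → H X
  H_retract : ∀ {X X' : D} (i : X' ⟶ X) (r : X ⟶ X'), i ≫ r = 𝟙 X' → H X → H X'
  H_biprod : ∀ {X Y : D}, H X → H Y → H (X ⊞ Y)
  hered : ∀ {X Y : D}, H X → H Y → ∀ {n : ℤ}, (n < 0 ∨ 2 ≤ n) → Van X Y n
  split : ∀ {X : D}, T₀ X → ∃ l : List (D × ℤ), (∀ p ∈ l, H p.1) ∧ Nonempty (X ≅ sumList l)

lemma exists_biproduct_iso_sumList [HasFiniteBiproducts D] : ∀ (n : ℕ) (f : Fin n → D)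
    (s : Fin n → ℤ), Nonempty ((⨁ fun j => (f j)⟦s j⟧) ≅
      sumList ((List.finRange n).map fun j => (f j, s j)))
  | 0, f, s => ⟨IsZero.iso (by
      rw [IsZero.iff_id_eq_zero]; exact biproduct.hom_ext' _ _ fun j => j.elim0) isZero_sumList_nil⟩
  | n + 1, f, s => by
    obtain ⟨e⟩ := exists_biproduct_iso_sumList n (fun j => f j.succ) (fun j => s j.succ)
    rw [List.finRange_succ, List.map_cons, List.map_map]
    let g : Fin (n + 1) → D := fun j => (f j)⟦s j⟧
    refine ⟨Iso.trans (Y := g 0 ⊞ ⨁ fun j : Fin n => g j.succ) ?_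
      (biprod.mapIso (Iso.refl _) e)⟩
    exact
    { hom := biprod.lift (biproduct.π g 0) (biproduct.lift fun j => biproduct.π g j.succ)
      inv := biprod.desc (biproduct.ι g 0) (biproduct.desc fun j => biproduct.ι g j.succ)
      hom_inv_id := by
        refine biproduct.hom_ext' _ _ fun j => ?_
        refine Fin.cases ?_ (fun j => ?_) j
        · rw [biprod.lift_desc, Preadditive.comp_add, biproduct.ι_π_self_assoc,
            Category.comp_id, biproduct.lift_desc, Preadditive.comp_sum,
            Finset.sum_eq_zero, add_zero]
          intro j _
          rw [biproduct.ι_π_ne_assoc, zero_comp]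
          exact (Fin.succ_ne_zero j).symm
        · rw [biprod.lift_desc, Preadditive.comp_add, biproduct.ι_π_ne_assoc _ (Fin.succ_ne_zero j),
            Category.comp_id, biproduct.lift_desc, Preadditive.comp_sum, zero_comp,
            Finset.sum_eq_single j, biproduct.ι_π_self_assoc, zero_add]
          · intro j' _ hj
            rw [biproduct.ι_π_ne_assoc, zero_comp]
            exact fun h => hj (Fin.succ_injective _ h).symm
          · simp
      inv_hom_id := by
        apply biprod.hom_ext'
        · apply biprod.hom_ext
          · simp
          · refine biproduct.hom_ext _ _ fun j => ?_
            simp [biproduct.ι_π_ne _ (Fin.succ_ne_zero j).symm]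
        · refine biproduct.hom_ext' _ _ fun j => ?_
          apply biprod.hom_ext
          · simp [biproduct.ι_π_ne _ (Fin.succ_ne_zero j)]
          · refine biproduct.hom_ext _ _ fun j' => ?_
            by_cases h : j = j'
            · subst h; simp
            · simp [biproduct.ι_π_ne _ h, biproduct.ι_π_ne _
                  (fun h' => h (Fin.succ_injective _ h'))] }

/-- `X'` is a retract of `X`. -/
def Retr (X' X : D) : Prop := ∃ (i : X' ⟶ X) (r : X ⟶ X'), i ≫ r = 𝟙 X'

namespace Retr

lemma trans {X Y Z : D} : Retr X Y → Retr Y Z → Retr X Z := fun ⟨i, r, h⟩ ⟨i', r', h'⟩ =>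
  ⟨i ≫ i', r' ≫ r, by simp [reassoc_of% h', h]⟩

lemma of_iso {X Y : D} (e : X ≅ Y) : Retr X Y := ⟨e.hom, e.inv, by simp⟩

lemma inl (X Y : D) : Retr X (X ⊞ Y) := ⟨biprod.inl, biprod.fst, by simp⟩

lemma inr (X Y : D) : Retr Y (X ⊞ Y) := ⟨biprod.inr, biprod.snd, by simp⟩

lemma shift {X Y : D} (n : ℤ) : Retr X Y → Retr (X⟦n⟧) (Y⟦n⟧) := fun ⟨i, r, h⟩ =>
  ⟨i⟦n⟧', r⟦n⟧', by rw [← Functor.map_comp, h, CategoryTheory.Functor.map_id]⟩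

lemma van_left {X X' Y : D} {n : ℤ} (h : Retr X' X) (hX : Van X Y n) : Van X' Y n :=
  let ⟨i, r, hir⟩ := h; hX.of_retract_left i r hir

lemma van_right {X Y Y' : D} {n : ℤ} (h : Retr Y' Y) (hX : Van X Y n) : Van X Y' n :=
  let ⟨i, r, hir⟩ := h; hX.of_retract_right i r hir

lemma mem {T : D → Prop} (hT : Thick T) {X X' : D} (h : Retr X' X) (hX : T X) : T X' :=
  let ⟨i, r, hir⟩ := h; hT.retract i r hir hX

end Retr

lemma retr_sumList {l : List (D × ℤ)} {p : D × ℤ} (h : p ∈ l) : Retr (p.1⟦p.2⟧) (sumList l) := by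
  induction l with
  | nil => simp at h
  | cons q l ih =>
    rcases List.mem_cons.1 h with rfl | h
    · exact Retr.inl _ _
    · exact (ih h).trans (Retr.inr _ _)

lemma setup_of_split {k : Type*} [Field k] [Linear k D] [HasFiniteBiproducts D] {B : D}
    (hB0 : ∀ i : ℤ, i ≠ 0 → Van B B i) (hBfd : FiniteDimensional k (B ⟶ B))
    {mod : Set D} (hered : ∀ X ∈ mod, ∀ Y ∈ mod, ∀ i : ℤ, (i < 0 ∨ 2 ≤ i) → Van X Y i)
    (split : ∀ X : D, IsThickOf D B X →
      ∃ (n : ℕ) (f : Fin n → D) (s : Fin n → ℤ),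
        (∀ j, f j ∈ mod) ∧ Nonempty (X ≅ ⨁ fun j => (f j)⟦s j⟧)) :
    Setup (CenterRing D) (IsThickOf D B) (Heart fun X => X ∈ mod ∧ IsThickOf D B X) where
  thick := thick_isThickOf B
  fin {X Y} hX hY := by
    refine thick_isThickOf_min (thick_finHom_left (thick_isThickOf B)) (fun Y hY => ?_) hX Y hY
    have := thick_isThickOf_min (thick_finHom_right (R := k) B) (fun n => ?_) hY 0
    · exact finHom_of_field (finHom_retract_right ((shiftFunctorZero D ℤ).inv.app Y)
        ((shiftFunctorZero D ℤ).hom.app Y) (by simp) this)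
    · by_cases hn : n = 0
      · subst hn
        have h : FinHom k B B := isFiniteLength_iff_isNoetherian_isArtinian.2
          ⟨inferInstance, inferInstance⟩
        exact finHom_retract_right ((shiftFunctorZero D ℤ).hom.app B)
          ((shiftFunctorZero D ℤ).inv.app B) (by simp) h
      · exact finHom_of_noHom (hB0 n hn)
  bdd {X Y} hX hY := by
    refine thick_isThickOf_min (thick_bdd_left (IsThickOf D B)) (fun Y hY => ?_) hX Y hY
    exact thick_isThickOf_min (thick_bdd_right B)
      ⟨0, fun n hn => hB0 n (abs_pos.1 hn)⟩ hY
  H_le {X} h := by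
    induction h with
    | base h => exact h.2
    | zero h => exact IsThickOf.zero _ h
    | biprod _ _ h h' => exact (thick_isThickOf B).biprod h h'
    | retract i r hir _ h => exact (thick_isThickOf B).retract i r hir h
  H_zero h := .zero h
  H_retract i r hir h := .retract i r hir h
  H_biprod h h' := .biprod h h'
  hered {X Y} hX hY n hn := by
    induction hX with
    | base hX =>
      induction hY with
      | base hY => exact hered _ hX.1 _ hY.1 n hn
      | zero h => exact van_of_isZero_right h n
      | biprod _ _ h h' => exact van_biprod_right h h'
      | retract i r hir _ h => exact h.of_retract_right i r hir
    | zero h => exact van_of_isZero_left h n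
    | biprod _ _ h h' => exact van_biprod_left h h'
    | retract i r hir _ h => exact h.of_retract_left i r hir
  split {X} hX := by
    obtain ⟨n, f, s, hf, ⟨e⟩⟩ := split X hX
    obtain ⟨e'⟩ := exists_biproduct_iso_sumList n f s
    refine ⟨_, fun p hp => ?_, ⟨e ≪≫ e'⟩⟩
    have hr := retr_sumList hp
    simp only [List.mem_map] at hp
    obtain ⟨j, -, rfl⟩ := hp
    refine .base ⟨hf j, ((thick_isThickOf B).shift_iff (s j)).1 ?_⟩
    exact hr.mem (thick_isThickOf B) ((thick_isThickOf B).iso (e ≪≫ e') hX)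

/-- A nonzero object whose only idempotent endomorphisms are trivial. -/
def Ind (M : D) : Prop := ¬ IsZero M ∧ ∀ e : M ⟶ M, e ≫ e = e → e = 0 ∨ e = 𝟙 M

lemma isZero_of_id_eq_zero {X : D} (h : 𝟙 X = 0) : IsZero X := (IsZero.iff_id_eq_zero X).2 h

lemma Ind.iso_of_retr {X Y : D} (hX : Ind X) (hY : ¬ IsZero Y) {i : Y ⟶ X} {r : X ⟶ Y}
    (h : i ≫ r = 𝟙 Y) : r ≫ i = 𝟙 X := by
  refine (hX.2 (r ≫ i) (by simp [reassoc_of% h])).resolve_left fun h0 => hY ?_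
  apply isZero_of_id_eq_zero
  calc 𝟙 Y = i ≫ (r ≫ i) ≫ r := by simp [h]
    _ = 0 := by rw [h0]; simp

lemma Ind.shift {X : D} (h : Ind X) (n : ℤ) : Ind (X⟦n⟧) := by
  refine ⟨fun h' => h.1 ((isZero_shift_iff n).1 h'), fun e he => ?_⟩
  obtain ⟨f, rfl⟩ := (shiftFunctor D n).map_surjective e
  rw [← Functor.map_comp] at he
  rcases h.2 f ((shiftFunctor D n).map_injective he) with rfl | rfl
  · exact Or.inl (by simp)
  · exact Or.inr (by simp)

/-- An exceptional object with a division ring of endomorphisms. -/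
structure Exc (X : D) : Prop where
  van : ∀ n : ℤ, n ≠ 0 → Van X X n
  ne : ¬ IsZero X
  isIso : ∀ f : X ⟶ X, f ≠ 0 → IsIso f

namespace Exc

lemma ind {X : D} (h : Exc X) : Ind X := by
  refine ⟨h.ne, fun e he => or_iff_not_imp_left.2 fun h0 => ?_⟩
  have := h.isIso e h0
  rwa [← cancel_epi e, Category.comp_id]

lemma iso {X Y : D} (h : Exc X) (e : X ≅ Y) : Exc Y where
  van n hn := (van_iso_left e).1 ((van_iso_right e).1 (h.van n hn))
  ne h' := h.ne (h'.of_iso e)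
  isIso f hf := by
    have := h.isIso (e.hom ≫ f ≫ e.inv) fun h0 => hf (by
      have : e.inv ≫ (e.hom ≫ f ≫ e.inv) ≫ e.hom = f := by simp
      rw [← this, h0]; simp)
    have h2 : f = e.inv ≫ (e.hom ≫ f ≫ e.inv) ≫ e.hom := by simp
    rw [h2]; infer_instance

lemma shift {X : D} (h : Exc X) (a : ℤ) : Exc (X⟦a⟧) where
  van n hn := (van_shift_left a n).2 ((van_shift_right a (n - a)).2 (h.van _ (by omega)))
  ne h' := h.ne ((isZero_shift_iff a).1 h')
  isIso f hf := by
    obtain ⟨g, rfl⟩ := (shiftFunctor D a).map_surjective f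
    have := h.isIso g (by rintro rfl; exact hf (by simp))
    infer_instance

end Exc

section Exact

variable {A M C : D} {f : A ⟶ M} {g : M ⟶ C} {h : C ⟶ A⟦(1 : ℤ)⟧}

lemma tri_zero₁₂ (hT : Triangle.mk f g h ∈ distTriang D) : f ≫ g = 0 :=
  comp_distTriang_mor_zero₁₂ _ hT

lemma tri_zero₂₃ (hT : Triangle.mk f g h ∈ distTriang D) : g ≫ h = 0 :=
  comp_distTriang_mor_zero₂₃ _ hT

lemma tri_zero₃₁ (hT : Triangle.mk f g h ∈ distTriang D) : h ≫ f⟦(1 : ℤ)⟧' = 0 :=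
  comp_distTriang_mor_zero₃₁ _ hT

lemma tri_from₂ (hT : Triangle.mk f g h ∈ distTriang D) {Y : D} (x : M ⟶ Y) (hx : f ≫ x = 0) :
    ∃ y : C ⟶ Y, x = g ≫ y :=
  Triangle.yoneda_exact₂ _ hT x hx

lemma tri_from₃ (hT : Triangle.mk f g h ∈ distTriang D) {Y : D} (x : C ⟶ Y) (hx : g ≫ x = 0) :
    ∃ y : A⟦(1 : ℤ)⟧ ⟶ Y, x = h ≫ y :=
  Triangle.yoneda_exact₃ _ hT x hx

lemma tri_to₂ (hT : Triangle.mk f g h ∈ distTriang D) {Y : D} (x : Y ⟶ M) (hx : x ≫ g = 0) :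
    ∃ y : Y ⟶ A, x = y ≫ f :=
  Triangle.coyoneda_exact₂ _ hT x hx

lemma tri_to₃ (hT : Triangle.mk f g h ∈ distTriang D) {Y : D} (x : Y ⟶ C) (hx : x ≫ h = 0) :
    ∃ y : Y ⟶ M, x = y ≫ g :=
  Triangle.coyoneda_exact₃ _ hT x hx

lemma tri_to₁ (hT : Triangle.mk f g h ∈ distTriang D) {Y : D} (x : Y ⟶ A⟦(1 : ℤ)⟧)
    (hx : x ≫ f⟦(1 : ℤ)⟧' = 0) : ∃ y : Y ⟶ C, x = y ≫ h :=
  Triangle.coyoneda_exact₁ _ hT x hx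

end Exact

/-- `f` is a monomorphism when tested on objects of `H`. -/
def MonoH (H : D → Prop) {M N : D} (f : M ⟶ N) : Prop :=
  ∀ A, H A → ∀ h : A ⟶ M, h ≫ f = 0 → h = 0

/-- `f` is an epimorphism when tested on objects of `H`. -/
def EpiH (H : D → Prop) {M N : D} (f : M ⟶ N) : Prop :=
  ∀ A, H A → ∀ h : N ⟶ A, f ≫ h = 0 → h = 0

lemma isZero_biprod {X Y : D} (hX : IsZero X) (hY : IsZero Y) : IsZero (X ⊞ Y) :=
  isZero_of_van (van_biprod_left (van_of_isZero_left hX 0) (van_of_isZero_left hY 0))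

lemma isZero_sumList {l : List (D × ℤ)} (h : ∀ p ∈ l, IsZero (p.1⟦p.2⟧)) :
    IsZero (sumList l) := by
  induction l with
  | nil => exact isZero_sumList_nil
  | cons p l ih => exact isZero_biprod (h p (by simp)) (ih fun q hq => h q (by simp [hq]))

lemma nonempty_iso_biprod {X : D} (hX : IsZero X) (Y : D) : Nonempty (Y ≅ X ⊞ Y) :=
  ⟨biprod.inr, biprod.snd, by simp, by
    apply biprod.hom_ext'
    · exact hX.eq_of_src _ _
    · simp⟩

/-- Shifts commute with biproducts. -/
noncomputable def shiftBiprod (X Y : D) (n : ℤ) : (X ⊞ Y)⟦n⟧ ≅ X⟦n⟧ ⊞ Y⟦n⟧ where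
  hom := biprod.lift (biprod.fst⟦n⟧') (biprod.snd⟦n⟧')
  inv := biprod.desc (biprod.inl⟦n⟧') (biprod.inr⟦n⟧')
  hom_inv_id := by
    rw [biprod.lift_desc, ← CategoryTheory.Functor.map_comp, ← CategoryTheory.Functor.map_comp,
      ← Functor.map_add, biprod.total, CategoryTheory.Functor.map_id]
  inv_hom_id := by
    ext <;> simp [← CategoryTheory.Functor.map_comp]

namespace Setup

variable {R : Type w} [Ring R] [Linear R D] {T₀ H : D → Prop} (S : Setup R T₀ H)
include S

lemma H_retr {X Y : D} (h : Retr X Y) (hY : H Y) : H X :=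
  let ⟨i, r, hir⟩ := h; S.H_retract i r hir hY

lemma noHom_neg {X Y : D} (hX : H X) (hY : H Y) : NoHom (X⟦(1 : ℤ)⟧) Y :=
  (noHom_shift_left 1).2 (S.hered hX hY (by omega))

lemma exists_two {l : List (D × ℤ)}
    (hl : ∀ p ∈ l, H p.1 ∧ (p.2 = 0 ∨ p.2 = 1 ∨ IsZero (p.1⟦p.2⟧))) :
    ∃ C₀ C₁ : D, H C₀ ∧ H C₁ ∧ Nonempty (sumList l ≅ C₀ ⊞ C₁⟦(1 : ℤ)⟧) := by
  induction l with
  | nil =>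
    refine ⟨sumList [], sumList [], S.H_zero isZero_sumList_nil, S.H_zero isZero_sumList_nil, ⟨?_⟩⟩
    exact IsZero.iso isZero_sumList_nil
      (isZero_biprod isZero_sumList_nil (isZero_shift isZero_sumList_nil 1))
  | cons p l ih =>
    obtain ⟨C₀, C₁, h₀, h₁, ⟨e⟩⟩ := ih fun q hq => hl q (by simp [hq])
    obtain ⟨M, s⟩ := p
    obtain ⟨hp, rfl | rfl | hz⟩ := hl (M, s) (by simp)
    · refine ⟨M ⊞ C₀, C₁, S.H_biprod hp h₀, h₁, ⟨?_⟩⟩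
      exact (biprod.mapIso ((shiftFunctorZero D ℤ).app M) e) ≪≫ (biprod.associator _ _ _).symm
    · refine ⟨C₀, M ⊞ C₁, h₀, S.H_biprod hp h₁, ⟨?_⟩⟩
      refine (biprod.mapIso (Iso.refl _) e) ≪≫ (biprod.associator _ _ _).symm ≪≫
        biprod.mapIso (biprod.braiding _ _) (Iso.refl _) ≪≫ biprod.associator _ _ _ ≪≫
        biprod.mapIso (Iso.refl _) (shiftBiprod M C₁ 1).symm
    · obtain ⟨e'⟩ := nonempty_iso_biprod hz (sumList l)
      exact ⟨C₀, C₁, h₀, h₁, ⟨e'.symm ≪≫ e⟩⟩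

/-- The cone of a morphism of the heart has two components. -/
lemma exists_cone_H {M N : D} (hM : H M) (hN : H N) (f : M ⟶ N) :
    ∃ (C₀ C₁ : D) (p : N ⟶ C₀ ⊞ C₁⟦(1 : ℤ)⟧) (q : C₀ ⊞ C₁⟦(1 : ℤ)⟧ ⟶ M⟦(1 : ℤ)⟧),
      H C₀ ∧ H C₁ ∧ Triangle.mk f p q ∈ distTriang D := by
  obtain ⟨C, p, q, hT⟩ := exists_cone f
  obtain ⟨l, hl, ⟨e⟩⟩ := S.split (S.thick.ext₃ hT (S.H_le hM) (S.H_le hN))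
  obtain ⟨C₀, C₁, h₀, h₁, ⟨e'⟩⟩ := S.exists_two (l := l) fun x hx => by
    refine ⟨hl x hx, ?_⟩
    have hr : Retr (x.1⟦x.2⟧) C := (retr_sumList hx).trans (Retr.of_iso e.symm)
    by_cases h0 : x.2 = 0
    · exact Or.inl h0
    by_cases h1 : x.2 = 1
    · exact Or.inr (Or.inl h1)
    refine Or.inr (Or.inr (isZero_of_van ?_))
    rcases lt_or_ge x.2 0 with h | h
    · apply hr.van_left
      refine van_tri₃' hT ?_ ?_
      · exact (van_shift_right _ _).2 (S.hered hN (hl x hx) (by omega))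
      · exact (van_shift_right _ _).2 (S.hered hM (hl x hx) (by omega))
    · apply hr.van_right
      refine van_tri₃ hT ?_ ?_
      · exact (van_shift_left _ _).2 (S.hered (hl x hx) hN (by omega))
      · exact (van_shift_left _ _).2 (S.hered (hl x hx) hM (by omega))
  refine ⟨C₀, C₁, p ≫ (e ≪≫ e').hom, (e ≪≫ e').inv ≫ q, h₀, h₁, ?_⟩
  refine isomorphic_distinguished _ hT _ (Triangle.isoMk _ _ (Iso.refl _) (Iso.refl _)
    (e ≪≫ e').symm ?_ ?_ ?_)
  · exact (Category.comp_id _).trans (Category.id_comp _).symm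
  · change (p ≫ (e ≪≫ e').hom) ≫ (e ≪≫ e').inv = 𝟙 _ ≫ p
    simp
  · change ((e ≪≫ e').inv ≫ q) ≫ (𝟙 M)⟦(1 : ℤ)⟧' = (e ≪≫ e').inv ≫ q
    simp

lemma idem_split {M : D} (hM : H M) (e : M ⟶ M) (he : e ≫ e = e) :
    ∃ (W : D) (i : W ⟶ M) (r : M ⟶ W), i ≫ r = 𝟙 W ∧ r ≫ i = 𝟙 M - e := by
  obtain ⟨C₀, C₁, u, v, h₀, h₁, hT⟩ := S.exists_cone_H hM hM e
  obtain ⟨r, hr⟩ := tri_from₂ hT (𝟙 M - e) (by simp [he])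
  have heu : e ≫ u = 0 := tri_zero₁₂ hT
  obtain ⟨t, ht⟩ := tri_from₃ hT (r ≫ u - 𝟙 _) (by
    rw [Preadditive.comp_sub, ← Category.assoc, ← hr]
    simp [heu])
  have hr1 : biprod.inr ≫ r = 0 := S.noHom_neg h₁ hM _
  have hr0 : u ≫ biprod.fst ≫ biprod.inl ≫ r = u ≫ r := by
    have : biprod.fst ≫ biprod.inl ≫ r = r := by
      apply biprod.hom_ext' <;> simp [hr1]
    rw [this]
  have ht0 : t ≫ biprod.fst = 0 := S.noHom_neg hM h₀ _
  have hru : r ≫ u = 𝟙 _ + v ≫ t := by rw [← ht]; abel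
  refine ⟨C₀, biprod.inl ≫ r, u ≫ biprod.fst, ?_, ?_⟩
  · rw [Category.assoc, reassoc_of% hru]
    simp [ht0]
  · rw [Category.assoc, hr0, hr]

lemma idem_split' {M : D} (hM : H M) (e : M ⟶ M) (he : e ≫ e = e) :
    ∃ (W : D) (i : W ⟶ M) (r : M ⟶ W), i ≫ r = 𝟙 W ∧ r ≫ i = e := by
  obtain ⟨W, i, r, h, h'⟩ := S.idem_split hM (𝟙 M - e) (by simp [he])
  exact ⟨W, i, r, h, by rw [h']; abel⟩

omit S in
lemma rightComp_pow {M : D} (f : End M) (n : ℕ) (g : M ⟶ M) :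
    ((Linear.rightComp R M (f : M ⟶ M)) ^ n) g = g ≫ (f ^ n : End M) := by
  induction n generalizing g with
  | zero => simp [End.one_def]
  | succ n ih =>
    rw [pow_succ, Module.End.mul_apply, ih, Linear.rightComp_apply, pow_succ', End.mul_def,
      Category.assoc]
    congr 1
    exact ((Commute.refl f).pow_right n).eq.symm

/-- Fitting's lemma. -/
lemma isUnit_or_isNilpotent {M : D} (hM : H M) (hI : Ind M) (f : End M) :
    IsUnit f ∨ IsNilpotent f := by
  have hfl := S.fin (S.H_le hM) (S.H_le hM)
  rw [isFiniteLength_iff_isNoetherian_isArtinian] at hfl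
  obtain ⟨h₁, h₂⟩ := hfl
  obtain ⟨n, hn⟩ := ((LinearMap.eventually_isCompl_ker_pow_range_pow
    (Linear.rightComp R M (f : M ⟶ M))).and (Filter.eventually_ge_atTop 1)).exists
  obtain ⟨hc, hn1⟩ := hn
  obtain ⟨e', he', e, ⟨a, rfl⟩, hee⟩ := Submodule.mem_sup.1
    (show 𝟙 M ∈ _ ⊔ _ from hc.sup_eq_top ▸ Submodule.mem_top)
  rw [LinearMap.mem_ker, rightComp_pow] at he'
  rw [rightComp_pow] at hee
  set F : M ⟶ M := (f ^ n : End M)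
  have key : ∀ x : M ⟶ M, (x ≫ F) ≫ F = 0 → x ≫ F = 0 := fun x hx => by
    have := hc.disjoint.le_bot (show x ≫ F ∈ _ ⊓ _ from ⟨by
      change _ = _
      rw [rightComp_pow]; exact hx, ⟨x, by rw [rightComp_pow]⟩⟩)
    exact this
  have hid : (a ≫ F) ≫ (a ≫ F) = a ≫ F := by
    have h1 : (a ≫ F ≫ e') ≫ F = 0 := by simp [he']
    have h0 : a ≫ F = a ≫ F ≫ e' + (a ≫ F) ≫ (a ≫ F) := by
      rw [← Category.assoc, ← Preadditive.comp_add, hee, Category.comp_id]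
    have h2 : (a - (a ≫ F) ≫ a) ≫ F = 0 := by
      apply key
      have : (a - (a ≫ F) ≫ a) ≫ F = a ≫ F ≫ e' := by
        rw [Preadditive.sub_comp, Category.assoc _ a F]
        exact sub_eq_of_eq_add h0
      rw [this, h1]
    rw [Preadditive.sub_comp, sub_eq_zero] at h2
    rw [← Category.assoc, ← h2]
  rcases hI.2 _ hid with h | h
  · refine Or.inr ⟨n, ?_⟩
    rw [h, add_zero] at hee
    rw [hee, Category.id_comp] at he'
    exact he'
  · left
    have h3 : F ≫ a = 𝟙 M := by
      have h2 : ((F ≫ a - 𝟙 M) ≫ a ≫ F) ≫ F = 0 := by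
        rw [h, Category.comp_id]; simp [h]
      rw [← Category.assoc] at h2
      have := key _ h2
      rw [Category.assoc, h, Category.comp_id, sub_eq_zero] at this
      exact this
    have : IsUnit (f ^ n) := ⟨⟨F, a, h, h3⟩, rfl⟩
    exact (isUnit_pow_iff (by omega)).1 this

end Setup

namespace Setup

variable {R : Type w} [Ring R] [Linear R D] {T₀ H : D → Prop} (S : Setup R T₀ H)
include S

/-- A morphism of the heart between indecomposable objects is a monomorphism or an epimorphism
when there are no extensions in the other direction. -/
lemma mono_or_epi {M N : D} (hM : H M) (hN : H N) (hMI : Ind M) (hNI : Ind N)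
    (hv : Van N M 1) {f : M ⟶ N} (hf : f ≠ 0) : MonoH H f ∨ EpiH H f := by
  obtain ⟨C₀, C₁, p, q, h₀, h₁, hT⟩ := S.exists_cone_H hM hN f
  obtain ⟨g, hg⟩ := tri_to₃ hT (p ≫ biprod.fst ≫ biprod.inl) (hv _)
  have hgg : g ≫ g ≫ p = g ≫ p := by
    rw [← hg, ← Category.assoc, ← hg]; simp
  rcases S.isUnit_or_isNilpotent hN hNI g with hu | ⟨n, hn⟩
  · left
    obtain ⟨g', hg'⟩ := hu.exists_left_inv
    have hg'' : g ≫ g' = 𝟙 N := hg'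
    obtain ⟨g₁, hg₁⟩ := hu.exists_right_inv
    have hg₁' : g₁ ≫ g = 𝟙 N := hg₁
    have hgp : g ≫ p = p := by
      have := congrArg (fun z => g₁ ≫ z) hgg
      simpa [reassoc_of% hg₁'] using this
    have hsnd : p ≫ biprod.snd = 0 := by
      rw [← hgp, ← hg]; simp
    obtain ⟨r, hr⟩ := tri_from₃ hT biprod.snd hsnd
    have hir : (biprod.inr ≫ q) ≫ r = 𝟙 _ := by rw [Category.assoc, ← hr]; simp
    have hz : IsZero (C₁⟦(1 : ℤ)⟧) := by
      by_contra hz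
      have h1 := (hMI.shift 1).iso_of_retr hz hir
      apply hf
      apply (shiftFunctor D (1 : ℤ)).map_injective
      rw [Functor.map_zero, ← Category.id_comp (f⟦(1 : ℤ)⟧'), ← h1]
      simp [tri_zero₃₁ hT]
    intro A hA h hh
    obtain ⟨y, hy⟩ := tri_to₁ hT (h⟦(1 : ℤ)⟧') (by
      rw [← CategoryTheory.Functor.map_comp, hh, Functor.map_zero])
    have hy0 : y = 0 := by
      apply biprod.hom_ext
      · rw [zero_comp]; exact S.noHom_neg hA h₀ _
      · exact hz.eq_of_tgt _ _
    apply (shiftFunctor D (1 : ℤ)).map_injective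
    rw [Functor.map_zero, hy, hy0, zero_comp]
  · right
    have hk : ∀ (k : ℕ) (G : End N), G = (show End N from g) ^ k → G ≫ g ≫ p = g ≫ p := by
      intro k
      induction k with
      | zero => rintro _ rfl; exact Category.id_comp _
      | succ k ih =>
        rintro _ rfl
        rw [pow_succ', End.mul_def, Category.assoc]
        exact (congrArg _ hgg).trans (ih _ rfl)
    have hgp : g ≫ p = 0 := by
      rw [← hk n _ rfl]
      exact (congrArg (fun z : N ⟶ N => z ≫ g ≫ p) hn).trans zero_comp
    have hfst : p ≫ biprod.fst = 0 := by
      have := congrArg (· ≫ biprod.fst) (hg.trans hgp)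
      simpa using this
    obtain ⟨r, hr⟩ := tri_from₃ hT biprod.fst hfst
    rw [S.noHom_neg hM h₀ r, comp_zero] at hr
    have hz : IsZero C₀ := isZero_of_id_eq_zero (by
      rw [← biprod.inl_fst (X := C₀) (Y := C₁⟦(1 : ℤ)⟧), hr, comp_zero])
    intro A hA h hh
    obtain ⟨y, hy⟩ := tri_from₂ hT h hh
    have hy0 : y = 0 := by
      apply biprod.hom_ext'
      · exact hz.eq_of_src _ _
      · rw [comp_zero]; exact S.noHom_neg h₁ hA _
    rw [hy, hy0, comp_zero]

lemma exc_of_ind {M : D} (hM : H M) (hI : Ind M) (hv : Van M M 1) : Exc M where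
  ne := hI.1
  van n hn := by
    by_cases h1 : n = 1
    · rw [h1]; exact hv
    · exact S.hered hM hM (by omega)
  isIso f hf := by
    rcases S.isUnit_or_isNilpotent hM hI f with hu | hn
    · exact (isUnit_iff_isIso f).1 hu
    · exfalso
      obtain ⟨G, hk, h1, h2⟩ : ∃ G : M ⟶ M, G ≠ 0 ∧ f ≫ G = 0 ∧ G ≫ f = 0 := by
        classical
        have h0 : Nat.find hn ≠ 0 := fun h => by
          have := Nat.find_spec hn
          rw [h, pow_zero] at this
          exact hI.1 (isZero_of_id_eq_zero this)
        obtain ⟨m, hm⟩ := Nat.exists_eq_succ_of_ne_zero h0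
        have hs := Nat.find_spec hn
        rw [hm] at hs
        exact ⟨(show End M from f) ^ m, Nat.find_min hn (by omega),
          (pow_succ (show End M from f) m).symm.trans hs,
          (pow_succ' (show End M from f) m).symm.trans hs⟩
      rcases S.mono_or_epi hM hM hI hI hv hf with h | h
      · exact hk (h M hM _ h2)
      · exact hk (h M hM _ h1)

/-- Every exceptional object is a shift of an exceptional object of the heart. -/
lemma exists_heart {X : D} (hX : T₀ X) (h : Exc X) :
    ∃ (M : D) (s : ℤ), H M ∧ Exc M ∧ Nonempty (X ≅ M⟦s⟧) := by
  obtain ⟨l, hl, ⟨e⟩⟩ := S.split hX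
  by_cases hz : ∀ p ∈ l, IsZero (p.1⟦p.2⟧)
  · exact (h.ne ((isZero_sumList hz).of_iso e)).elim
  · push Not at hz
    obtain ⟨p, hp, hpz⟩ := hz
    obtain ⟨i, r, hir⟩ := (retr_sumList hp).trans (Retr.of_iso e.symm)
    have e' : X ≅ p.1⟦p.2⟧ := ⟨r, i, h.ind.iso_of_retr hpz hir, hir⟩
    refine ⟨p.1, p.2, hl p hp, ?_, ⟨e'⟩⟩
    have := (h.iso e').shift (-p.2)
    exact this.iso ((shiftFunctorCompIsoId D p.2 (-p.2) (by simp)).app p.1)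

lemma ind_decomp {M : D} (hM : H M) : ∃ l : List D,
    (∀ a ∈ l, H a ∧ Ind a ∧ Retr a M) ∧ ∀ T : D → Prop, Thick T → (∀ a ∈ l, T a) → T M := by
  obtain ⟨n, hn⟩ : ∃ n : ℕ, Module.length R (M ⟶ M) ≤ n := by
    have := Module.length_ne_top_iff.2 (S.fin (S.H_le hM) (S.H_le hM))
    obtain ⟨n, hn⟩ := ENat.ne_top_iff_exists.1 this
    exact ⟨n, hn.ge⟩
  induction n generalizing M with
  | zero =>
    have hz : IsZero M := isZero_of_id_eq_zero (by
      have : Module.length R (M ⟶ M) = 0 := by simpa using hn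
      rw [Module.length_eq_zero_iff] at this
      exact Subsingleton.elim _ _)
    exact ⟨[], by simp, fun T hT _ => hT.zero hz⟩
  | succ n ih =>
    by_cases hz : IsZero M
    · exact ⟨[], by simp, fun T hT _ => hT.zero hz⟩
    by_cases hI : Ind M
    · exact ⟨[M], by simpa using ⟨hM, hI, Retr.of_iso (Iso.refl M)⟩, fun T hT h => h M (by simp)⟩
    have : ∃ e : M ⟶ M, e ≫ e = e ∧ e ≠ 0 ∧ e ≠ 𝟙 M := by
      by_contra hc
      push Not at hc
      exact hI ⟨hz, fun e he => or_iff_not_imp_left.2 fun h0 => hc e he h0⟩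
    obtain ⟨e, he, h0, h1⟩ := this
    have key : ∀ e : M ⟶ M, e ≠ 𝟙 M → ∀ (W : D) (i : W ⟶ M) (r : M ⟶ W), i ≫ r = 𝟙 W →
        r ≫ i = e → Module.length R (W ⟶ W) ≤ n := by
      intro e h1 W i r hir hri
      have hlt : Module.length R (W ⟶ W) < Module.length R (M ⟶ M) := by
        let φ : (W ⟶ W) →ₗ[R] (M ⟶ M) := (Linear.leftComp R M r).comp (Linear.rightComp R W i)
        have hφ : Function.Injective φ := fun a b hab => by
          have hab' : r ≫ a ≫ i = r ≫ b ≫ i := hab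
          have := congrArg (fun z => i ≫ z ≫ r) hab'
          simpa [hir, reassoc_of% hir] using this
        have hne : LinearMap.range φ ≠ ⊤ := fun ht => by
          obtain ⟨a, ha⟩ : 𝟙 M ∈ LinearMap.range φ := ht ▸ Submodule.mem_top
          have ha' : r ≫ a ≫ i = 𝟙 M := ha
          apply h1
          rw [← hri, ← Category.comp_id (r ≫ i), ← ha']
          simp [reassoc_of% hir]
        rw [(LinearEquiv.ofInjective φ hφ).length_eq]
        have := S.fin (S.H_le hM) (S.H_le hM)
        rw [isFiniteLength_iff_isNoetherian_isArtinian] at this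
        obtain ⟨_, _⟩ := this
        exact Submodule.length_lt hne
      have := hlt.trans_le hn
      exact Order.le_of_lt_add_one (by simpa using this)
    obtain ⟨W, i, r, hir, hri⟩ := S.idem_split hM e he
    obtain ⟨W', i', r', hir', hri'⟩ := S.idem_split' hM e he
    have hW : Retr W M := ⟨i, r, hir⟩
    have hW' : Retr W' M := ⟨i', r', hir'⟩
    obtain ⟨l, hl, hl'⟩ := ih (S.H_retr hW hM) (key _ (fun h => h0 (by simpa using h)) W i r hir
        hri)
    obtain ⟨m, hm, hm'⟩ := ih (S.H_retr hW' hM) (key _ h1 W' i' r' hir' hri')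
    refine ⟨l ++ m, fun a ha => ?_, fun T hT h => ?_⟩
    · rcases List.mem_append.1 ha with h | h
      · exact ⟨(hl a h).1, (hl a h).2.1, (hl a h).2.2.trans hW⟩
      · exact ⟨(hm a h).1, (hm a h).2.1, (hm a h).2.2.trans hW'⟩
    · refine hT.retract (biprod.lift r r') (biprod.desc i i') ?_ (hT.biprod
        (hl' T hT fun a ha => h a (by simp [ha])) (hm' T hT fun a ha => h a (by simp [ha])))
      rw [biprod.lift_desc, hri, hri']; abel

end Setup

/-- There is a nonzero morphism between the non-isomorphic objects `a` and `b` of `P`. -/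
def Link (P : List D) (a b : D) : Prop :=
  a ∈ P ∧ b ∈ P ∧ IsEmpty (a ≅ b) ∧ ∃ f : a ⟶ b, f ≠ 0

lemma Exc.nonempty_iso {a b : D} (ha : Exc a) (hb : Exc b) {f : a ⟶ b} {g : b ⟶ a}
    (h : f ≫ g ≠ 0) : Nonempty (a ≅ b) := by
  have := ha.isIso _ h
  have h1 : f ≫ g ≫ inv (f ≫ g) = 𝟙 a := by rw [← Category.assoc, IsIso.hom_inv_id]
  exact ⟨⟨f, g ≫ inv (f ≫ g), h1, hb.ind.iso_of_retr ha.ne h1⟩⟩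

/-- A finite list can be sorted along a relation having minimal elements. -/
lemma exists_sorted {α : Type*} (l : List α) (r s : α → α → Prop) (hs : ∀ a, s a a)
    (h : ∀ l' : List α, l' ≠ [] → (∀ a ∈ l', a ∈ l) → ∃ m ∈ l', ∀ b ∈ l', s m b ∨ r m b) :
    ∃ l' : List α, (∀ a ∈ l', a ∈ l) ∧ l'.Pairwise r ∧ ∀ b ∈ l, ∃ a ∈ l', s a b := by
  classical
  obtain ⟨n, hn⟩ : ∃ n, l.length ≤ n := ⟨_, le_rfl⟩
  induction n generalizing l with
  | zero =>
    obtain rfl : l = [] := by simpa using hn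
    exact ⟨[], by simp, by simp, by simp⟩
  | succ n ih =>
    by_cases hl : l = []
    · subst hl; exact ⟨[], by simp, by simp, by simp⟩
    obtain ⟨m, hm, hmb⟩ := h l hl fun _ h => h
    obtain ⟨l', h1, h2, h3⟩ := ih (l.filter fun b => ¬ s m b)
      (fun l' hl' hh => h l' hl' fun a ha => (List.mem_filter.1 (hh a ha)).1) (by
        have : (l.filter fun b => ¬ s m b).length < l.length :=
          List.length_filter_lt_length_iff_exists.2 ⟨m, hm, by simpa using hs m⟩
        omega)
    refine ⟨m :: l', ?_, ?_, ?_⟩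
    · intro a ha
      rcases List.mem_cons.1 ha with rfl | ha
      · exact hm
      · exact (List.mem_filter.1 (h1 a ha)).1
    · refine List.pairwise_cons.2 ⟨fun b hb => ?_, h2⟩
      obtain ⟨hb, hb'⟩ := List.mem_filter.1 (h1 b hb)
      exact (hmb b hb).resolve_left (by simpa using hb')
    · intro b hb
      by_cases hsb : s m b
      · exact ⟨m, by simp, hsb⟩
      · obtain ⟨a, ha, hab⟩ := h3 b (List.mem_filter.2 ⟨hb, by simpa using hsb⟩)
        exact ⟨a, by simp [ha], hab⟩

namespace Setup

variable {R : Type w} [Ring R] [Linear R D] {T₀ H : D → Prop} (S : Setup R T₀ H)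
include S

lemma link_reduce {P : List D} (hP : ∀ a ∈ P, H a ∧ Exc a)
    (hP1 : ∀ a ∈ P, ∀ b ∈ P, Van a b 1) {a b c d : D} (h₁ : Link P a b) (h₂ : Link P b c)
    (h₃ : Link P c d) : Link P a d ∨ ∃ b, Link P a b ∧ Link P b d := by
  obtain ⟨ha, hb, hab, f, hf⟩ := h₁
  obtain ⟨-, hc, hbc, g, hg⟩ := h₂
  obtain ⟨-, hd, hcd, h, hh⟩ := h₃
  right
  by_cases hfg : f ≫ g = 0
  · have hgm : ¬ MonoH H g := fun hm => hf (hm a (hP a ha).1 f hfg)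
    have hge := (S.mono_or_epi (hP b hb).1 (hP c hc).1 (hP b hb).2.ind (hP c hc).2.ind
      (hP1 c hc b hb) hg).resolve_left hgm
    have hgh : g ≫ h ≠ 0 := fun h0 => hh (hge d (hP d hd).1 h h0)
    refine ⟨b, ⟨ha, hb, hab, f, hf⟩, hb, hd, ⟨fun e => ?_⟩, _, hgh⟩
    have : g ≫ h ≫ e.inv ≠ 0 := fun h0 => hgh (by
      rw [← cancel_mono e.inv, Category.assoc, h0, zero_comp])
    exact hbc.elim ((hP b hb).2.nonempty_iso (hP c hc).2 this).some
  · refine ⟨c, ⟨ha, hc, ⟨fun e => ?_⟩, _, hfg⟩, hc, hd, hcd, h, hh⟩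
    have : f ≫ g ≫ e.inv ≠ 0 := fun h0 => hfg (by
      rw [← cancel_mono e.inv, Category.assoc, h0, zero_comp])
    exact hab.elim ((hP a ha).2.nonempty_iso (hP b hb).2 this).some

lemma link_acyclic {P : List D} (hP : ∀ a ∈ P, H a ∧ Exc a)
    (hP1 : ∀ a ∈ P, ∀ b ∈ P, Van a b 1) {a : D} (h : Relation.TransGen (Link P) a a) : False := by
  have key : ∀ d, Relation.TransGen (Link P) a d →
      Link P a d ∨ ∃ b, Link P a b ∧ Link P b d := by
    intro d hd
    induction hd with
    | single h => exact Or.inl h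
    | tail _ h ih =>
      rcases ih with h' | ⟨b, h', h''⟩
      · exact Or.inr ⟨_, h', h⟩
      · exact S.link_reduce hP hP1 h' h'' h
  rcases key a h with ⟨-, -, h, -⟩ | ⟨b, ⟨ha, hb, hab, f, hf⟩, -, -, -, g, hg⟩
  · exact h.elim (Iso.refl a)
  · by_cases hfg : f ≫ g = 0
    · have hgm : ¬ MonoH H g := fun hm => hf (hm a (hP a ha).1 f hfg)
      have hge := (S.mono_or_epi (hP b hb).1 (hP a ha).1 (hP b hb).2.ind (hP a ha).2.ind
        (hP1 a ha b hb) hg).resolve_left hgm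
      have hgf : g ≫ f ≠ 0 := fun h0 => hf (hge b (hP b hb).1 f h0)
      exact hab.elim ((hP b hb).2.nonempty_iso (hP a ha).2 hgf).some.symm
    · exact hab.elim ((hP a ha).2.nonempty_iso (hP b hb).2 hfg).some

lemma exists_first {P : List D} (hne : P ≠ []) (hP : ∀ a ∈ P, H a ∧ Exc a)
    (hP1 : ∀ a ∈ P, ∀ b ∈ P, Van a b 1) :
    ∃ m ∈ P, ∀ b ∈ P, Nonempty (m ≅ b) ∨ NoHom m b := by
  let q : {x // x ∈ P} → {x // x ∈ P} → Prop := fun x y => Relation.TransGen (Link P) y.1 x.1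
  have : Finite {x // x ∈ P} := List.finite_toSet P
  have : IsTrans _ q := ⟨fun a b c h h' => h'.trans h⟩
  have : Std.Irrefl q := ⟨fun a h => S.link_acyclic hP hP1 h⟩
  have hw : WellFounded q := Finite.wellFounded_of_trans_of_irrefl q
  obtain ⟨x, hx⟩ := List.exists_mem_of_ne_nil P hne
  obtain ⟨m, -, hm⟩ := hw.has_min Set.univ ⟨⟨x, hx⟩, trivial⟩
  refine ⟨m.1, m.2, fun b hb => or_iff_not_imp_left.2 fun hi f => ?_⟩
  by_contra hf
  exact hm ⟨b, hb⟩ trivial (.single ⟨m.2, hb, not_nonempty_iff.1 hi, f, hf⟩)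

/-- A presilting object generates the same thick subcategory as an exceptional sequence. -/
lemma exists_exc_list {V : D} (hV : T₀ V) (hVV : ∀ i : ℤ, 0 < i → Van V V i) :
    ∃ l : List D, (∀ a ∈ l, Exc a ∧ ∀ T : D → Prop, Thick T → T V → T a) ∧
      l.Pairwise Orth ∧ ∀ T : D → Prop, Thick T → (∀ a ∈ l, T a) → T V := by
  obtain ⟨l₀, hl₀, ⟨e⟩⟩ := S.split hV
  obtain ⟨L, hL, hLT⟩ : ∃ L : List (D × ℤ),
      (∀ p ∈ L, H p.1 ∧ Ind p.1 ∧ Retr (p.1⟦p.2⟧) V) ∧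
      ∀ T : D → Prop, Thick T → (∀ p ∈ L, T p.1) → T V := by
    have hr : ∀ p ∈ l₀, Retr (p.1⟦p.2⟧) V := fun p hp =>
      (retr_sumList hp).trans (Retr.of_iso e.symm)
    suffices h : ∀ l : List (D × ℤ), (∀ p ∈ l, H p.1 ∧ Retr (p.1⟦p.2⟧) V) →
        ∃ L : List (D × ℤ), (∀ p ∈ L, H p.1 ∧ Ind p.1 ∧ Retr (p.1⟦p.2⟧) V) ∧
          ∀ T : D → Prop, Thick T → (∀ p ∈ L, T p.1) → T (sumList l) by
      obtain ⟨L, hL, hL'⟩ := h l₀ fun p hp => ⟨hl₀ p hp, hr p hp⟩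
      exact ⟨L, hL, fun T hT h => hT.iso e.symm (hL' T hT h)⟩
    intro l hl
    induction l with
    | nil => exact ⟨[], by simp, fun T hT _ => hT.zero isZero_sumList_nil⟩
    | cons p l ih =>
      obtain ⟨L, hL, hL'⟩ := ih fun q hq => hl q (by simp [hq])
      obtain ⟨hp, hpr⟩ := hl p (by simp)
      obtain ⟨m, hm, hm'⟩ := S.ind_decomp hp
      refine ⟨m.map (fun a => (a, p.2)) ++ L, fun x hx => ?_, fun T hT h => ?_⟩
      · rcases List.mem_append.1 hx with h | h
        · obtain ⟨a, ha, rfl⟩ := List.mem_map.1 h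
          exact ⟨(hm a ha).1, (hm a ha).2.1, ((hm a ha).2.2.shift p.2).trans hpr⟩
        · exact hL x h
      · exact hT.biprod
          (hT.shift (hm' T hT fun a ha => h (a, p.2) (by simp [ha])) _)
          (hL' T hT fun x hx => h x (by simp [hx]))
  have hvan : ∀ p ∈ L, ∀ q ∈ L, ∀ n : ℤ, q.2 - p.2 < n → Van p.1 q.1 n := by
    intro p hp q hq n hn
    have h1 : Van (p.1⟦p.2⟧) (q.1⟦q.2⟧) (n - q.2 + p.2) :=
      (hL p hp).2.2.van_left ((hL q hq).2.2.van_right (hVV _ (by omega)))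
    rw [van_shift_left, van_shift_right] at h1
    convert h1 using 1; ring
  have hexc : ∀ p ∈ L, H p.1 ∧ Exc p.1 := fun p hp =>
    ⟨(hL p hp).1, S.exc_of_ind (hL p hp).1 (hL p hp).2.1 (hvan p hp p hp 1 (by omega))⟩
  have horth : ∀ p ∈ L, ∀ q ∈ L, q.2 < p.2 ∨ q.2 = p.2 ∧ NoHom p.1 q.1 → Orth p.1 q.1 := by
    intro p hp q hq h n
    by_cases hn : n < 0 ∨ 2 ≤ n
    · exact S.hered (hL p hp).1 (hL q hq).1 hn
    · rcases h with h | ⟨h, h'⟩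
      · exact hvan p hp q hq n (by omega)
      · by_cases h0 : n = 0
        · rw [h0]; exact van_zero.2 h'
        · exact hvan p hp q hq n (by omega)
  obtain ⟨l', h1, h2, h3⟩ := exists_sorted L (fun p q => Orth p.1 q.1)
    (fun p q => Nonempty (p.1 ≅ q.1)) (fun p => ⟨Iso.refl _⟩) (by
      intro l' hne hl'
      obtain ⟨x, hx, hmax⟩ : ∃ x ∈ l', ∀ y ∈ l', y.2 ≤ x.2 := by
        obtain ⟨x, hx⟩ := List.exists_mem_of_ne_nil l' hne
        obtain ⟨x, hx, h⟩ := Set.exists_max_image {y | y ∈ l'} (fun y => y.2)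
          (List.finite_toSet l') ⟨x, hx⟩
        exact ⟨x, hx, h⟩
      classical
      let P := (l'.filter fun y => y.2 = x.2).map Prod.fst
      have hP : ∀ a ∈ P, (a, x.2) ∈ l' := by
        intro a ha
        obtain ⟨y, hy, rfl⟩ := List.mem_map.1 ha
        obtain ⟨hy, hy'⟩ := List.mem_filter.1 hy
        have : y.2 = x.2 := by simpa using hy'
        rwa [← this]
      obtain ⟨m, hm, hmb⟩ := S.exists_first (P := P)
        (List.ne_nil_of_mem (List.mem_map.2 ⟨x, List.mem_filter.2 ⟨hx, by simp⟩, rfl⟩))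
        (fun a ha => hexc _ (hl' _ (hP a ha)))
        (fun a ha b hb => hvan _ (hl' _ (hP a ha)) _ (hl' _ (hP b hb)) 1 (by simp))
      refine ⟨_, hP m hm, fun b hb => ?_⟩
      rcases lt_or_eq_of_le (hmax b hb) with h | h
      · exact Or.inr (horth _ (hl' _ (hP m hm)) b (hl' b hb) (Or.inl h))
      · rcases hmb b.1 (List.mem_map.2 ⟨b, List.mem_filter.2 ⟨hb, by simpa using h⟩, rfl⟩) with
          h' | h'
        · exact Or.inl h'
        · exact Or.inr (horth _ (hl' _ (hP m hm)) b (hl' b hb) (Or.inr ⟨h, h'⟩)))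
  refine ⟨l'.map Prod.fst, fun a ha => ?_, ?_, fun T hT h => ?_⟩
  · obtain ⟨p, hp, rfl⟩ := List.mem_map.1 ha
    exact ⟨(hexc p (h1 p hp)).2, fun T hT hTV =>
      (hT.shift_iff p.2).1 ((hL p (h1 p hp)).2.2.mem hT hTV)⟩
  · exact List.pairwise_map.2 h2
  · refine hLT T hT fun q hq => ?_
    obtain ⟨p, hp, ⟨e⟩⟩ := h3 q hq
    exact hT.iso e (h p.1 (List.mem_map_of_mem hp))

end Setup

/-- The length of a module, as a natural number. -/
noncomputable def natLength (R : Type w) (M : Type*) [Ring R] [AddCommGroup M] [Module R M] : ℕ :=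
  (Module.length R M).toNat

section Length

variable {R : Type w} [Ring R] {M N : Type*} [AddCommGroup M] [AddCommGroup N] [Module R M]
  [Module R N]

lemma natLength_eq_add (hM : IsFiniteLength R M) (φ : M →ₗ[R] N) :
    natLength R M = natLength R (LinearMap.ker φ) + natLength R (LinearMap.range φ) := by
  have h := Module.length_eq_add_of_exact (LinearMap.ker φ).subtype φ.rangeRestrict
    (Submodule.injective_subtype _) φ.surjective_rangeRestrict
    (by rw [LinearMap.exact_iff]; simp)
  have h1 := Module.length_ne_top_iff.2 hM
  rw [h] at h1
  have h2 : Module.length R (LinearMap.ker φ) ≠ ⊤ := fun hh => h1 (by rw [hh]; simp)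
  have h3 : Module.length R (LinearMap.range φ) ≠ ⊤ := fun hh => h1 (by rw [hh]; simp)
  unfold natLength
  rw [h, ENat.toNat_add h2 h3]

lemma natLength_top : natLength R (⊤ : Submodule R M) = natLength R M := by
  unfold natLength
  rw [Module.length_top]

lemma natLength_eq_zero [Subsingleton M] : natLength R M = 0 := by
  unfold natLength
  rw [Module.length_eq_zero]; rfl

lemma natLength_pos (hM : IsFiniteLength R M) (h : ∃ x : M, x ≠ 0) : 0 < natLength R M := by
  rw [Nat.pos_iff_ne_zero]
  intro h0
  unfold natLength at h0
  rw [ENat.toNat_eq_zero] at h0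
  have := Module.length_eq_zero_iff.1 (h0.resolve_right (Module.length_ne_top_iff.2 hM))
  obtain ⟨x, hx⟩ := h
  exact hx (Subsingleton.elim _ _)

lemma natLength_le_of_surjective (hM : IsFiniteLength R M) (φ : M →ₗ[R] N)
    (hφ : Function.Surjective φ) : natLength R N ≤ natLength R M := by
  rw [natLength_eq_add hM φ, LinearMap.range_eq_top.2 hφ, natLength_top]
  omega

lemma natLength_lt_of_surjective (hM : IsFiniteLength R M) (φ : M →ₗ[R] N)
    (hφ : Function.Surjective φ) {x : M} (hx : x ≠ 0) (hx0 : φ x = 0) :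
    natLength R N < natLength R M := by
  rw [natLength_eq_add hM φ, LinearMap.range_eq_top.2 hφ, natLength_top]
  have : 0 < natLength R (LinearMap.ker φ) := natLength_pos
    (IsFiniteLength.of_injective hM (Submodule.injective_subtype _))
    ⟨⟨x, hx0⟩, fun h => hx (congrArg Subtype.val h)⟩
  omega

end Length

lemma Orth.noHom {X Y : D} (h : Orth X Y) : NoHom X Y := van_zero.1 (h 0)

/-- Successive cones of nonzero morphisms from shifts of `X`. -/
inductive RChain (X : D) : D → D → Prop
  | refl (Y : D) : RChain X Y Y
  | step {j : ℤ} {Y Y₁ L : D} {f : X⟦j⟧ ⟶ Y} {g : Y ⟶ Y₁} {h : Y₁ ⟶ X⟦j⟧⟦(1 : ℤ)⟧}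
      (hT : Triangle.mk f g h ∈ distTriang D) (hf : f ≠ 0) (hL : RChain X Y₁ L) : RChain X Y L

/-- Successive fibers of nonzero morphisms to shifts of `X`. -/
inductive LChain (X : D) : D → D → Prop
  | refl (Y : D) : LChain X Y Y
  | step {j : ℤ} {Y Y₁ L : D} {g : Y₁ ⟶ Y} {f : Y ⟶ X⟦j⟧} {h : X⟦j⟧ ⟶ Y₁⟦(1 : ℤ)⟧}
      (hT : Triangle.mk g f h ∈ distTriang D) (hf : f ≠ 0) (hL : LChain X Y₁ L) : LChain X Y L

lemma Exc.noHom_shift' {X : D} (h : Exc X) {i j : ℤ} (hij : i ≠ j + 1) :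
    NoHom (X⟦i⟧) (X⟦j⟧⟦(1 : ℤ)⟧) :=
  (noHom_shift_left i).2 ((van_shift_right 1 (-i)).2 ((van_shift_right j _).2
    (h.van _ (by omega))))

section RStep

variable {X Y Y₁ : D} {j : ℤ} {f : X⟦j⟧ ⟶ Y} {g : Y ⟶ Y₁} {h : Y₁ ⟶ X⟦j⟧⟦(1 : ℤ)⟧}

lemma rStep_surjective (hX : Exc X) (hT : Triangle.mk f g h ∈ distTriang D) (hf : f ≠ 0) (i : ℤ)
    (x : X⟦i⟧ ⟶ Y₁) : ∃ y : X⟦i⟧ ⟶ Y, x = y ≫ g := by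
  apply tri_to₃ hT
  by_cases hij : i = j + 1
  · subst hij
    by_contra h0
    let e : X⟦j + 1⟧ ≅ X⟦j⟧⟦(1 : ℤ)⟧ := (shiftFunctorAdd D j 1).app X
    have := ((hX.shift j).shift 1).isIso (e.inv ≫ x ≫ h) fun h1 => h0 (by
      rw [← cancel_epi e.inv, h1, comp_zero])
    have h2 : (e.inv ≫ x ≫ h) ≫ f⟦(1 : ℤ)⟧' = 0 := by simp [tri_zero₃₁ hT]
    have h3 : f⟦(1 : ℤ)⟧' = 0 := by rw [← cancel_epi (e.inv ≫ x ≫ h), h2, comp_zero]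
    exact hf ((shiftFunctor D (1 : ℤ)).map_injective (by rw [h3, Functor.map_zero]))
  · exact hX.noHom_shift' hij _

lemma rStep_van (hX : Exc X) (hT : Triangle.mk f g h ∈ distTriang D) (hf : f ≠ 0) {d : ℤ}
    (hd : Van X Y d) : Van X Y₁ d := by
  have : NoHom (X⟦-d⟧) Y₁ := fun x => by
    obtain ⟨y, rfl⟩ := rStep_surjective hX hT hf _ x
    rw [(noHom_shift_left (-d)).2 (by simpa using hd) y, zero_comp]
  simpa using (noHom_shift_left (-d)).1 this

lemma not_van_of_ne_zero (hf : f ≠ 0) : ¬ Van X Y (-j) := fun h =>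
  hf ((noHom_shift_left j).2 h f)

end RStep

section LStep

variable {X Y Y₁ : D} {j : ℤ} {g : Y₁ ⟶ Y} {f : Y ⟶ X⟦j⟧} {h : X⟦j⟧ ⟶ Y₁⟦(1 : ℤ)⟧}

lemma lStep_surjective (hX : Exc X) (hT : Triangle.mk g f h ∈ distTriang D) (hf : f ≠ 0) (i : ℤ)
    (x : Y₁ ⟶ X⟦i⟧) : ∃ y : Y ⟶ X⟦i⟧, x = g ≫ y := by
  have h0 : h ≫ x⟦(1 : ℤ)⟧' = 0 := by
    by_cases hij : j = i + 1
    · subst hij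
      by_contra h0
      let e : X⟦i + 1⟧ ≅ X⟦i⟧⟦(1 : ℤ)⟧ := (shiftFunctorAdd D i 1).app X
      have := (hX.shift (i + 1)).isIso ((h ≫ x⟦(1 : ℤ)⟧') ≫ e.inv) fun h1 => h0 (by
        rw [← cancel_mono e.inv, h1, zero_comp])
      have h2 : f ≫ (h ≫ x⟦(1 : ℤ)⟧') ≫ e.inv = 0 := by
        rw [Category.assoc, reassoc_of% (tri_zero₂₃ hT), zero_comp]
      exact hf (by rw [← cancel_mono ((h ≫ x⟦(1 : ℤ)⟧') ≫ e.inv), h2, zero_comp])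
    · exact hX.noHom_shift' hij _
  have hT' := rot_of_distTriang _ (rot_of_distTriang _ hT)
  obtain ⟨y, hy⟩ : ∃ y : Y⟦(1 : ℤ)⟧ ⟶ X⟦i⟧⟦(1 : ℤ)⟧, x⟦(1 : ℤ)⟧' = (-g⟦(1 : ℤ)⟧') ≫ y :=
    Triangle.yoneda_exact₂ _ hT' (x⟦(1 : ℤ)⟧') h0
  obtain ⟨z, rfl⟩ := (shiftFunctor D (1 : ℤ)).map_surjective y
  refine ⟨-z, (shiftFunctor D (1 : ℤ)).map_injective ?_⟩
  rw [hy]; simp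

lemma lStep_van (hX : Exc X) (hT : Triangle.mk g f h ∈ distTriang D) (hf : f ≠ 0) {d : ℤ}
    (hd : Van Y X d) : Van Y₁ X d := fun x => by
  obtain ⟨y, rfl⟩ := lStep_surjective hX hT hf _ x
  rw [hd y, comp_zero]

end LStep

namespace RChain

variable {X Y L : D}

lemma mem (c : RChain X Y L) {T : D → Prop} (hT : Thick T) (hX : T X) (hY : T Y) : T L := by
  induction c with
  | refl => exact hY
  | step h _ _ ih => exact ih (hT.ext₃ h (hT.shift hX _) hY)

lemma mem' (c : RChain X Y L) {T : D → Prop} (hT : Thick T) (hX : T X) (hL : T L) : T Y := by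
  induction c with
  | refl => exact hL
  | step h _ _ ih => exact hT.ext h (hT.shift hX _) (ih hL)

lemma van_to (c : RChain X Y L) (hX : Exc X) {Z : D} {n : ℤ}
    (h : ∀ d, ¬ Van X Y d → Van Z X (n + 1 - d)) (hY : Van Z Y n) : Van Z L n := by
  induction c with
  | refl => exact hY
  | step hT hf _ ih =>
    exact ih (fun d hd => h d fun hd' => hd (rStep_van hX hT hf hd')) (van_tri₃ hT hY
      ((van_shift_right _ _).2 (by
        have := h _ (not_van_of_ne_zero hf)
        convert this using 1; ring)))

lemma van_to' (c : RChain X Y L) (hX : Exc X) {Z : D} {n : ℤ}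
    (h : ∀ d, ¬ Van X Y d → Van Z X (n - d)) (hL : Van Z L n) : Van Z Y n := by
  induction c with
  | refl => exact hL
  | step hT hf _ ih =>
    exact van_tri₂ hT ((van_shift_right _ _).2 (by
        have := h _ (not_van_of_ne_zero hf)
        convert this using 1; ring))
      (ih (fun d hd => h d fun hd' => hd (rStep_van hX hT hf hd')) hL)

lemma van_from (c : RChain X Y L) (hX : Exc X) {Z : D} {n : ℤ}
    (h : ∀ d, ¬ Van X Y d → Van X Z (n - 1 + d)) (hY : Van Y Z n) : Van L Z n := by
  induction c with
  | refl => exact hY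
  | step hT hf _ ih =>
    exact ih (fun d hd => h d fun hd' => hd (rStep_van hX hT hf hd')) (van_tri₃' hT hY
      ((van_shift_left _ _).2 (by
        have := h _ (not_van_of_ne_zero hf)
        convert this using 1; ring)))

lemma van_from' (c : RChain X Y L) (hX : Exc X) {Z : D} {n : ℤ}
    (h : ∀ d, ¬ Van X Y d → Van X Z (n + d)) (hL : Van L Z n) : Van Y Z n := by
  induction c with
  | refl => exact hL
  | step hT hf _ ih =>
    exact van_tri₂' hT ((van_shift_left _ _).2 (by
        have := h _ (not_van_of_ne_zero hf)
        convert this using 1; ring))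
      (ih (fun d hd => h d fun hd' => hd (rStep_van hX hT hf hd')) hL)

lemma exists_hom (c : RChain X Y L) : ∃ φ : Y ⟶ L,
    (∀ Z, Orth Z X → Function.Bijective fun u : Z ⟶ Y => u ≫ φ) ∧
    (∀ Z, Orth X Z → Function.Bijective fun u : L ⟶ Z => φ ≫ u) := by
  induction c with
  | refl => exact ⟨𝟙 _, fun Z _ => ⟨fun u v h => by simpa using h, fun u => ⟨u, by simp⟩⟩,
      fun Z _ => ⟨fun u v h => by simpa using h, fun u => ⟨u, by simp⟩⟩⟩
  | step hT _ _ ih =>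
    rename_i j Y Y₁ L f g h _ _
    obtain ⟨φ, h1, h2⟩ := ih
    refine ⟨g ≫ φ, fun Z hZ => ?_, fun Z hZ => ?_⟩
    · have : Function.Bijective fun u : Z ⟶ Y => u ≫ g := by
        refine ⟨(injective_iff_map_eq_zero (Preadditive.rightComp Z g)).2 fun u hu => ?_,
          fun u => ?_⟩
        · obtain ⟨y, rfl⟩ := tri_to₂ hT u hu
          rw [hZ j y, zero_comp]
        · obtain ⟨y, rfl⟩ := tri_to₃ hT u
            (((orth_shift_right 1).2 ((orth_shift_right j).2 hZ)).noHom _)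
          exact ⟨y, rfl⟩
      simpa [Function.comp_def] using (h1 Z hZ).comp this
    · have : Function.Bijective fun u : Y₁ ⟶ Z => g ≫ u := by
        refine ⟨(injective_iff_map_eq_zero (Preadditive.leftComp Z g)).2 fun u hu => ?_,
          fun u => ?_⟩
        · obtain ⟨y, rfl⟩ := tri_from₃ hT u hu
          rw [(noHom_shift_left 1).2 ((van_shift_left j _).2 (hZ _)) y, comp_zero]
        · obtain ⟨y, rfl⟩ := tri_from₂ hT u ((noHom_shift_left j).2 (hZ _) _)
          exact ⟨y, rfl⟩
      simpa [Function.comp_def] using this.comp (h2 Z hZ)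

lemma exc (c : RChain X Y L) (hX : Exc X) (hY : Exc Y) (hYX : Orth Y X) (hXL : Orth X L) :
    Exc L := by
  obtain ⟨φ, h1, h2⟩ := c.exists_hom
  refine ⟨fun n hn => c.van_from hX (fun d _ => hXL _) (c.van_to hX (fun d _ => hYX _)
    (hY.van n hn)), fun hz => hY.ne (isZero_of_id_eq_zero ((h1 Y hYX).1 (hz.eq_of_tgt _ _))),
    fun f hf => ?_⟩
  obtain ⟨g, hg⟩ := (h1 Y hYX).2 (φ ≫ f)
  have hg0 : g ≠ 0 := by
    rintro rfl
    exact hf ((h2 L hXL).1 (by simpa using hg.symm))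
  have := hY.isIso g hg0
  obtain ⟨f', hf'⟩ := (h2 L hXL).2 (inv g ≫ φ)
  dsimp only at hg hf'
  refine ⟨f', (h2 L hXL).1 ?_, (h2 L hXL).1 ?_⟩
  · dsimp only
    rw [← reassoc_of% hg, hf']; simp
  · dsimp only
    rw [reassoc_of% hf', ← hg]; simp

end RChain

namespace LChain

variable {X Y L : D}

lemma mem (c : LChain X Y L) {T : D → Prop} (hT : Thick T) (hX : T X) (hY : T Y) : T L := by
  induction c with
  | refl => exact hY
  | step h _ _ ih => exact ih (hT.ext₁ h hY (hT.shift hX _))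

lemma van_from (c : LChain X Y L) (hX : Exc X) {Z : D} {n : ℤ}
    (h : ∀ d, ¬ Van Y X d → Van X Z (n + 1 - d)) (hY : Van Y Z n) : Van L Z n := by
  induction c with
  | refl => exact hY
  | step hT hf _ ih =>
    exact ih (fun d hd => h d fun hd' => hd (lStep_van hX hT hf hd')) (van_tri₁' hT
      ((van_shift_left _ _).2 (h _ fun h' => hf (h' _))) hY)

lemma van_from' (c : LChain X Y L) (hX : Exc X) {Z : D} {n : ℤ}
    (h : ∀ d, ¬ Van Y X d → Van X Z (n - d)) (hL : Van L Z n) : Van Y Z n := by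
  induction c with
  | refl => exact hL
  | step hT hf _ ih =>
    exact van_tri₂' hT
      (ih (fun d hd => h d fun hd' => hd (lStep_van hX hT hf hd')) hL)
      ((van_shift_left _ _).2 (h _ fun h' => hf (h' _)))

lemma van_to (c : LChain X Y L) (hX : Exc X) {Z : D} {n : ℤ}
    (h : ∀ d, ¬ Van Y X d → Van Z X (n - 1 + d)) (hY : Van Z Y n) : Van Z L n := by
  induction c with
  | refl => exact hY
  | step hT hf _ ih =>
    exact ih (fun d hd => h d fun hd' => hd (lStep_van hX hT hf hd')) (van_tri₁ hT
      ((van_shift_right _ _).2 (by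
        have := h _ fun h' => hf (h' _)
        convert this using 1; ring)) hY)

lemma van_to' (c : LChain X Y L) (hX : Exc X) {Z : D} {n : ℤ}
    (h : ∀ d, ¬ Van Y X d → Van Z X (n + d)) (hL : Van Z L n) : Van Z Y n := by
  induction c with
  | refl => exact hL
  | step hT hf _ ih =>
    exact van_tri₂ hT (ih (fun d hd => h d fun hd' => hd (lStep_van hX hT hf hd')) hL)
      ((van_shift_right _ _).2 (by
        have := h _ fun h' => hf (h' _)
        convert this using 1; ring))

lemma exists_hom (c : LChain X Y L) : ∃ φ : L ⟶ Y,
    (∀ Z, Orth Z X → Function.Bijective fun u : Z ⟶ L => u ≫ φ) ∧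
    (∀ Z, Orth X Z → Function.Bijective fun u : Y ⟶ Z => φ ≫ u) := by
  induction c with
  | refl => exact ⟨𝟙 _, fun Z _ => ⟨fun u v h => by simpa using h, fun u => ⟨u, by simp⟩⟩,
      fun Z _ => ⟨fun u v h => by simpa using h, fun u => ⟨u, by simp⟩⟩⟩
  | step hT _ _ ih =>
    rename_i j Y Y₁ L g f h _ _
    obtain ⟨φ, h1, h2⟩ := ih
    refine ⟨φ ≫ g, fun Z hZ => ?_, fun Z hZ => ?_⟩
    · have : Function.Bijective fun u : Z ⟶ Y₁ => u ≫ g := by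
        refine ⟨(injective_iff_map_eq_zero (Preadditive.rightComp Z g)).2 fun u hu => ?_,
          fun u => ?_⟩
        · obtain ⟨y, hy⟩ := tri_to₁ hT (u⟦(1 : ℤ)⟧') (by
            rw [← CategoryTheory.Functor.map_comp]
            exact (congrArg _ hu).trans (Functor.map_zero _ _ _))
          apply (shiftFunctor D (1 : ℤ)).map_injective
          rw [hy, (noHom_shift_left 1).2 ((van_shift_right j _).2 (hZ _)) y, zero_comp,
            Functor.map_zero]
        · obtain ⟨y, rfl⟩ := tri_to₂ hT u (hZ j _)
          exact ⟨y, rfl⟩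
      simpa [Function.comp_def] using this.comp (h1 Z hZ)
    · have : Function.Bijective fun u : Y ⟶ Z => g ≫ u := by
        refine ⟨(injective_iff_map_eq_zero (Preadditive.leftComp Z g)).2 fun u hu => ?_,
          fun u => ?_⟩
        · obtain ⟨y, rfl⟩ := tri_from₂ hT u hu
          rw [(noHom_shift_left j).2 (hZ _) y, comp_zero]
        · have h0 : h ≫ u⟦(1 : ℤ)⟧' = 0 := 
            ((orth_shift_left j).2 ((orth_shift_right 1).2 hZ)).noHom _
          obtain ⟨y, hy⟩ : ∃ y : Y⟦(1 : ℤ)⟧ ⟶ Z⟦(1 : ℤ)⟧, u⟦(1 : ℤ)⟧' = (-g⟦(1 : ℤ)⟧') ≫ y :=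
            Triangle.yoneda_exact₂ _ (rot_of_distTriang _ (rot_of_distTriang _ hT))
              (u⟦(1 : ℤ)⟧') h0
          obtain ⟨z, rfl⟩ := (shiftFunctor D (1 : ℤ)).map_surjective y
          refine ⟨-z, (shiftFunctor D (1 : ℤ)).map_injective ?_⟩
          rw [hy]; simp
      simpa [Function.comp_def] using (h2 Z hZ).comp this

lemma exc (c : LChain X Y L) (hX : Exc X) (hY : Exc Y) (hXY : Orth X Y) (hLX : Orth L X) :
    Exc L := by
  obtain ⟨φ, h1, h2⟩ := c.exists_hom
  refine ⟨fun n hn => c.van_to hX (fun d _ => hLX _) (c.van_from hX (fun d _ => hXY _)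
    (hY.van n hn)), fun hz => hY.ne (isZero_of_id_eq_zero ((h2 Y hXY).1 (hz.eq_of_src _ _))),
    fun f hf => ?_⟩
  obtain ⟨g, hg⟩ := (h2 Y hXY).2 (f ≫ φ)
  have hg0 : g ≠ 0 := by
    rintro rfl
    exact hf ((h1 L hLX).1 (by simpa using hg.symm))
  have := hY.isIso g hg0
  obtain ⟨f', hf'⟩ := (h1 L hLX).2 (φ ≫ inv g)
  dsimp only at hg hf'
  refine ⟨f', (h1 L hLX).1 ?_, (h1 L hLX).1 ?_⟩
  · dsimp only
    rw [Category.assoc, hf', ← reassoc_of% hg]; simp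
  · dsimp only
    rw [Category.assoc, ← hg, reassoc_of% hf']; simp

end LChain

lemma thick_orth_right (X : D) : Thick fun Y => Orth X Y where
  zero h := fun _ => van_of_isZero_right h _
  shift h n := (orth_shift_right n).2 h
  ext H h₁ h₃ := fun n => van_tri₂ H (h₁ n) (h₃ n)
  retract i r hir h := fun n => (h n).of_retract_right i r hir

lemma thick_orth_left (Y : D) : Thick fun X => Orth X Y where
  zero h := fun _ => van_of_isZero_left h _
  shift h n := (orth_shift_left n).2 h
  ext H h₁ h₃ := fun n => van_tri₂' H (h₁ n) (h₃ n)
  retract i r hir h := fun n => (h n).of_retract_left i r hir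

/-- The predicate `T` is generated by a full exceptional sequence. -/
inductive Full : (D → Prop) → Prop
  | zero (T : D → Prop) (h : ∀ Y, T Y → IsZero Y) : Full T
  | step (T : D → Prop) (X : D) (hX : Exc X) (hTX : T X) (h : Full (RPerp T X)) : Full T

lemma Full.congr {T T' : D → Prop} (h : Full T) (hT : ∀ Y, T Y ↔ T' Y) : Full T' := by
  obtain rfl : T = T' := funext fun Y => propext (hT Y)
  exact h

/-- Exceptional sequences in `T` have length at most `n`. -/
def Rk (n : ℕ) (T : D → Prop) : Prop :=
  ∀ l : List D, (∀ a ∈ l, Exc a ∧ T a) → l.Pairwise Orth → l.length ≤ n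

lemma Rk.mono {n : ℕ} {T T' : D → Prop} (h : Rk n T) (hT : ∀ Y, T' Y → T Y) : Rk n T' :=
  fun l hl => h l fun a ha => ⟨(hl a ha).1, hT a (hl a ha).2⟩

lemma Rk.rPerp {n : ℕ} {T : D → Prop} {X : D} (h : Rk (n + 1) T) (hX : Exc X) (hTX : T X) :
    Rk n (RPerp T X) := fun l hl hl' => by
  have := h (X :: l) (fun a ha => by
    rcases List.mem_cons.1 ha with rfl | ha
    · exact ⟨hX, hTX⟩
    · exact ⟨(hl a ha).1, (hl a ha).2.1⟩)
    (List.pairwise_cons.2 ⟨fun a ha => (hl a ha).2.2, hl'⟩)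
  simpa using this

lemma Rk.lPerp {n : ℕ} {T : D → Prop} {X : D} (h : Rk (n + 1) T) (hX : Exc X) (hTX : T X) :
    Rk n (LPerp T X) := fun l hl hl' => by
  have := h (l ++ [X]) (fun a ha => by
    rcases List.mem_append.1 ha with ha | ha
    · exact ⟨(hl a ha).1, (hl a ha).2.1⟩
    · obtain rfl : a = X := by simpa using ha
      exact ⟨hX, hTX⟩)
    (List.pairwise_append.2 ⟨hl', by simp, fun a ha b hb => by
      obtain rfl : b = X := by simpa using hb
      exact (hl a ha).2.2⟩)
  simpa using this

/-- The objects of `T` receiving no morphisms from the members of `l`. -/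
def RPerpList (T : D → Prop) (l : List D) : D → Prop := fun Y => T Y ∧ ∀ a ∈ l, Orth a Y

/-- The objects of `T` having no morphisms to the members of `l`. -/
def LPerpList (T : D → Prop) (l : List D) : D → Prop := fun Y => T Y ∧ ∀ a ∈ l, Orth Y a

/-- Right orthogonals of exceptional objects are generated by exceptional sequences
in predicates of rank at most `n`. -/
def Complements (T₀ : D → Prop) (n : ℕ) : Prop :=
  ∀ T : D → Prop, Thick T → (∀ Y, T Y → T₀ Y) → Rk n T → Full T →
    ∀ E, Exc E → T E → Full (RPerp T E)

lemma full_of_rPerpList {T : D → Prop} {l : List D} (hT : Thick T)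
    (hl : ∀ a ∈ l, Exc a ∧ T a) (hl' : l.Pairwise Orth) (h : Full (RPerpList T l)) : Full T := by
  induction l generalizing T with
  | nil => exact h.congr fun Y => by simp [RPerpList]
  | cons a l ih =>
    obtain ⟨h1, h2⟩ := List.pairwise_cons.1 hl'
    refine Full.step T a (hl a (by simp)).1 (hl a (by simp)).2 (ih (hT.rPerp a)
      (fun b hb => ⟨(hl b (by simp [hb])).1, (hl b (by simp [hb])).2, h1 b hb⟩) h2
      (h.congr fun Y => ?_))
    simp [RPerpList, RPerp, and_assoc]

lemma Complements.rPerpList {T₀ : D → Prop} {n : ℕ} (hC : Complements T₀ n) {T : D → Prop}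
    {l : List D} (hT : Thick T) (hT₀ : ∀ Y, T Y → T₀ Y) (hR : Rk n T) (hF : Full T)
    (hl : ∀ a ∈ l, Exc a ∧ T a) (hl' : l.Pairwise Orth) : Full (RPerpList T l) := by
  induction l generalizing T with
  | nil => exact hF.congr fun Y => by simp [RPerpList]
  | cons a l ih =>
    obtain ⟨h1, h2⟩ := List.pairwise_cons.1 hl'
    refine (ih (hT.rPerp a) (fun Y hY => hT₀ Y hY.1) (hR.mono fun Y hY => hY.1)
      (hC T hT hT₀ hR hF a (hl a (by simp)).1 (hl a (by simp)).2)
      (fun b hb => ⟨(hl b (by simp [hb])).1, (hl b (by simp [hb])).2, h1 b hb⟩) h2).congr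
      fun Y => ?_
    simp [RPerpList, RPerp, and_assoc]

namespace Setup

variable {R : Type w} [Ring R] [Linear R D] {T₀ H : D → Prop} (S : Setup R T₀ H)
include S

lemma exists_rChain {X Y : D} (hTX : T₀ X) (hX : Exc X) (hY : T₀ Y) :
    ∃ L, RChain X Y L ∧ Orth X L := by
  obtain ⟨N, hN⟩ := S.bdd hTX hY
  replace hN : ∀ n ∉ Finset.Icc (-N) N, Van X Y n := fun n hn => hN n (by
    rw [Finset.mem_Icc, ← abs_le] at hn; omega)
  induction hk : ∑ n ∈ Finset.Icc (-N) N, natLength R (X⟦n⟧ ⟶ Y) using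
    Nat.strong_induction_on generalizing Y with
  | _ k ih =>
    by_cases ho : Orth X Y
    · exact ⟨Y, RChain.refl Y, ho⟩
    obtain ⟨d, hd⟩ : ∃ d, ¬ Van X Y d := by
      by_contra h; push Not at h; exact ho h
    obtain ⟨f, hf⟩ : ∃ f : X⟦-d⟧ ⟶ Y, f ≠ 0 := by
      by_contra h
      push Not at h
      exact hd (by simpa using (noHom_shift_left (-d)).1 h)
    obtain ⟨Y₁, g, h, hT⟩ := exists_cone f
    have hY₁ : T₀ Y₁ := S.thick.ext₃ hT (S.thick.shift hTX _) hY
    obtain ⟨L, hL, hL'⟩ := ih _ (by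
      rw [← hk]
      refine Finset.sum_lt_sum (fun n _ => ?_) ⟨-d, ?_, ?_⟩
      · exact natLength_le_of_surjective (S.fin (S.thick.shift hTX n) hY)
          (Linear.rightComp R _ g) fun x => by
            obtain ⟨y, rfl⟩ := rStep_surjective hX hT hf n x; exact ⟨y, rfl⟩
      · by_contra hn
        refine hd (hN d fun hd' => hn ?_)
        rw [Finset.mem_Icc] at hd' ⊢
        omega
      · exact natLength_lt_of_surjective (S.fin (S.thick.shift hTX (-d)) hY)
          (Linear.rightComp R _ g) (fun x => by
            obtain ⟨y, rfl⟩ := rStep_surjective hX hT hf (-d) x; exact ⟨y, rfl⟩) hf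
          (tri_zero₁₂ hT)) hY₁ (fun n hn => rStep_van hX hT hf (hN n hn)) rfl
    exact ⟨L, RChain.step hT hf hL, hL'⟩

lemma exists_lChain {X Y : D} (hTX : T₀ X) (hX : Exc X) (hY : T₀ Y) :
    ∃ L, LChain X Y L ∧ Orth L X := by
  obtain ⟨N, hN⟩ := S.bdd hY hTX
  replace hN : ∀ n ∉ Finset.Icc (-N) N, Van Y X n := fun n hn => hN n (by
    rw [Finset.mem_Icc, ← abs_le] at hn; omega)
  induction hk : ∑ n ∈ Finset.Icc (-N) N, natLength R (Y ⟶ X⟦n⟧) using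
    Nat.strong_induction_on generalizing Y with
  | _ k ih =>
    by_cases ho : Orth Y X
    · exact ⟨Y, LChain.refl Y, ho⟩
    obtain ⟨d, hd⟩ : ∃ d, ¬ Van Y X d := by
      by_contra h; push Not at h; exact ho h
    obtain ⟨f, hf⟩ : ∃ f : Y ⟶ X⟦d⟧, f ≠ 0 := by
      by_contra h
      push Not at h
      exact hd h
    obtain ⟨Y₁, g, h, hT⟩ := exists_fiber f
    have hY₁ : T₀ Y₁ := S.thick.ext₁ hT hY (S.thick.shift hTX _)
    obtain ⟨L, hL, hL'⟩ := ih _ (by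
      rw [← hk]
      refine Finset.sum_lt_sum (fun n _ => ?_) ⟨d, ?_, ?_⟩
      · exact natLength_le_of_surjective (S.fin hY (S.thick.shift hTX n))
          (Linear.leftComp R _ g) fun x => by
            obtain ⟨y, rfl⟩ := lStep_surjective hX hT hf n x; exact ⟨y, rfl⟩
      · by_contra hn
        exact hd (hN d hn)
      · exact natLength_lt_of_surjective (S.fin hY (S.thick.shift hTX d))
          (Linear.leftComp R _ g) (fun x => by
            obtain ⟨y, rfl⟩ := lStep_surjective hX hT hf d x; exact ⟨y, rfl⟩) hf
          (tri_zero₁₂ hT)) hY₁ (fun n hn => lStep_van hX hT hf (hN n hn)) rfl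
    exact ⟨L, LChain.step hT hf hL, hL'⟩

lemma transfer_left {F : D → Prop} (hF : Full F) {T : D → Prop} (hT : Thick T)
    (hT₀ : ∀ Y, T Y → T₀ Y) {X : D} (hX : Exc X) (hTX : T X) (h : ∀ Y, F Y ↔ RPerp T X Y) :
    Full (LPerp T X) := by
  induction hF generalizing T with
  | zero F hF =>
    refine Full.zero _ fun Y hY => ?_
    obtain ⟨L, hL, hL'⟩ := S.exists_rChain (hT₀ X hTX) hX (hT₀ Y hY.1)
    have hz : IsZero L := hF L ((h L).2 ⟨hL.mem hT hTX hY.1, hL'⟩)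
    exact isZero_of_van (hL.van_to' hX (fun d _ => hY.2 _) (van_of_isZero_right hz 0))
  | step F Z hZ hFZ _ ih =>
    obtain ⟨hTZ, hXZ⟩ := (h Z).1 hFZ
    obtain ⟨Z', hc, hc'⟩ := S.exists_lChain (hT₀ X hTX) hX (hT₀ Z hTZ)
    have hTZ' := hc.mem hT hTX hTZ
    refine Full.step _ Z' (hc.exc hX hZ hXZ hc') ⟨hTZ', hc'⟩ ?_
    refine (ih (hT.rPerp Z') (fun Y hY => hT₀ Y hY.1) ⟨hTX, hc'⟩ fun Y => ?_).congr fun Y =>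
      and_right_comm
    refine Iff.trans (and_congr_left' (h Y)) ⟨fun hY => ⟨⟨hY.1.1, fun n => ?_⟩, hY.1.2⟩,
      fun hY => ⟨⟨hY.1.1, hY.2⟩, fun n => ?_⟩⟩
    · exact hc.van_from hX (fun d _ => hY.1.2 _) (hY.2 n)
    · exact hc.van_from' hX (fun d _ => hY.2 _) (hY.1.2 n)

lemma transfer_right {F : D → Prop} (hF : Full F) {T : D → Prop} (hT : Thick T)
    (hT₀ : ∀ Y, T Y → T₀ Y) {X : D} (hX : Exc X) (hTX : T X) (h : ∀ Y, F Y ↔ LPerp T X Y) :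
    Full (RPerp T X) := by
  induction hF generalizing T with
  | zero F hF =>
    refine Full.zero _ fun Y hY => ?_
    obtain ⟨L, hL, hL'⟩ := S.exists_lChain (hT₀ X hTX) hX (hT₀ Y hY.1)
    have hz : IsZero L := hF L ((h L).2 ⟨hL.mem hT hTX hY.1, hL'⟩)
    exact isZero_of_van (hL.van_from' hX (fun d _ => hY.2 _) (van_of_isZero_left hz 0))
  | step F Z hZ hFZ _ ih =>
    obtain ⟨hTZ, hZX⟩ := (h Z).1 hFZ
    obtain ⟨Z', hc, hc'⟩ := S.exists_rChain (hT₀ X hTX) hX (hT₀ Z hTZ)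
    refine Full.step _ Z' (hc.exc hX hZ hZX hc') ⟨hc.mem hT hTX hTZ, hc'⟩ ?_
    refine (ih (hT.rPerp Z) (fun Y hY => hT₀ Y hY.1) ⟨hTX, hZX⟩ fun Y => ?_).congr fun Y => ?_
    · exact Iff.trans (and_congr_left' (h Y)) and_right_comm
    · refine ⟨fun hY => ⟨⟨hY.1.1, hY.2⟩, fun n => ?_⟩, fun hY => ⟨⟨hY.1.1, fun n => ?_⟩, hY.1.2⟩⟩
      · exact hc.van_from hX (fun d _ => hY.2 _) (hY.1.2 n)
      · exact hc.van_from' hX (fun d _ => hY.1.2 _) (hY.2 n)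

lemma transfer {T : D → Prop} (hT : Thick T) (hT₀ : ∀ Y, T Y → T₀ Y) {X : D} (hX : Exc X)
    (hTX : T X) : Full (RPerp T X) ↔ Full (LPerp T X) :=
  ⟨fun h => S.transfer_left h hT hT₀ hX hTX fun _ => Iff.rfl,
    fun h => S.transfer_right h hT hT₀ hX hTX fun _ => Iff.rfl⟩

lemma full_of_lPerpList {T : D → Prop} {l : List D} (hT : Thick T) (hT₀ : ∀ Y, T Y → T₀ Y)
    (hl : ∀ a ∈ l, Exc a ∧ T a) (hl' : l.Pairwise Orth) (h : Full (LPerpList T l)) : Full T := by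
  induction l using List.reverseRecOn generalizing T with
  | nil => exact h.congr fun Y => by simp [LPerpList]
  | append_singleton l a ih =>
    obtain ⟨h1, -, h2⟩ := List.pairwise_append.1 hl'
    have ha := hl a (by simp)
    refine Full.step T a ha.1 ha.2 ((S.transfer hT hT₀ ha.1 ha.2).2 (ih (hT.lPerp a)
      (fun Y hY => hT₀ Y hY.1) (fun b hb => ⟨(hl b (by simp [hb])).1, (hl b (by simp [hb])).2,
        h2 b hb a (by simp)⟩) h1 (h.congr fun Y => ?_)))
    simp only [LPerpList, LPerp, List.mem_append, List.mem_singleton]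
    grind

lemma lPerpList_of_complements {n : ℕ} (hC : Complements T₀ n) {T : D → Prop}
    {l : List D} (hT : Thick T) (hT₀ : ∀ Y, T Y → T₀ Y) (hR : Rk n T) (hF : Full T)
    (hl : ∀ a ∈ l, Exc a ∧ T a) (hl' : l.Pairwise Orth) : Full (LPerpList T l) := by
  induction l using List.reverseRecOn generalizing T with
  | nil => exact hF.congr fun Y => by simp [LPerpList]
  | append_singleton l a ih =>
    obtain ⟨h1, -, h2⟩ := List.pairwise_append.1 hl'
    have ha := hl a (by simp)
    refine (ih (hT.lPerp a) (fun Y hY => hT₀ Y hY.1) (hR.mono fun Y hY => hY.1)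
      ((S.transfer hT hT₀ ha.1 ha.2).1 (hC T hT hT₀ hR hF a ha.1 ha.2))
      (fun b hb => ⟨(hl b (by simp [hb])).1, (hl b (by simp [hb])).2,
        h2 b hb a (by simp)⟩) h1).congr fun Y => ?_
    simp only [LPerpList, LPerp, List.mem_append, List.mem_singleton]
    grind

/-- A presilting object of `T` has the same orthogonals as an exceptional sequence of `T`. -/
lemma exists_list {T : D → Prop} (hT : Thick T) (hT₀ : ∀ Y, T Y → T₀ Y) {V : D} (hV : T V)
    (hVV : ∀ i : ℤ, 0 < i → Van V V i) : ∃ l : List D, (∀ a ∈ l, Exc a ∧ T a) ∧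
      l.Pairwise Orth ∧ (∀ Y, RPerpList T l Y ↔ RPerp T V Y) ∧
      (∀ Y, LPerpList T l Y ↔ LPerp T V Y) ∧
      ∀ T' : D → Prop, Thick T' → T' V → ∀ a ∈ l, T' a := by
  obtain ⟨l, h1, h2, h3⟩ := S.exists_exc_list (hT₀ V hV) hVV
  refine ⟨l, fun a ha => ⟨(h1 a ha).1, (h1 a ha).2 T hT hV⟩, h2, fun Y => ?_, fun Y => ?_,
    fun T' hT' h a ha => (h1 a ha).2 T' hT' h⟩
  · exact and_congr_right fun _ => ⟨fun h => h3 _ (thick_orth_left Y) h,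
      fun h a ha => (h1 a ha).2 _ (thick_orth_left Y) h⟩
  · exact and_congr_right fun _ => ⟨fun h => h3 _ (thick_orth_right Y) h,
      fun h a ha => (h1 a ha).2 _ (thick_orth_right Y) h⟩

lemma full_of_rPerp {T : D → Prop} (hT : Thick T) (hT₀ : ∀ Y, T Y → T₀ Y) {V : D} (hV : T V)
    (hVV : ∀ i : ℤ, 0 < i → Van V V i) (h : Full (RPerp T V)) : Full T := by
  obtain ⟨l, h1, h2, h3, -⟩ := S.exists_list hT hT₀ hV hVV
  exact full_of_rPerpList hT h1 h2 (h.congr fun Y => (h3 Y).symm)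

lemma full_of_lPerp {T : D → Prop} (hT : Thick T) (hT₀ : ∀ Y, T Y → T₀ Y) {V : D} (hV : T V)
    (hVV : ∀ i : ℤ, 0 < i → Van V V i) (h : Full (LPerp T V)) : Full T := by
  obtain ⟨l, h1, h2, -, h3, -⟩ := S.exists_list hT hT₀ hV hVV
  exact S.full_of_lPerpList hT hT₀ h1 h2 (h.congr fun Y => (h3 Y).symm)

lemma rPerp_full {n : ℕ} (hC : Complements T₀ n) {T : D → Prop} (hT : Thick T)
    (hT₀ : ∀ Y, T Y → T₀ Y) (hR : Rk n T) (hF : Full T) {V : D} (hV : T V)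
    (hVV : ∀ i : ℤ, 0 < i → Van V V i) : Full (RPerp T V) := by
  obtain ⟨l, h1, h2, h3, -⟩ := S.exists_list hT hT₀ hV hVV
  exact (hC.rPerpList hT hT₀ hR hF h1 h2).congr h3

lemma lPerp_full {n : ℕ} (hC : Complements T₀ n) {T : D → Prop} (hT : Thick T)
    (hT₀ : ∀ Y, T Y → T₀ Y) (hR : Rk n T) (hF : Full T) {V : D} (hV : T V)
    (hVV : ∀ i : ℤ, 0 < i → Van V V i) : Full (LPerp T V) := by
  obtain ⟨l, h1, h2, -, h3, -⟩ := S.exists_list hT hT₀ hV hVV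
  exact (S.lPerpList_of_complements hC hT hT₀ hR hF h1 h2).congr h3

end Setup

section Euler

variable (R : Type w) [Ring R] [Linear R D]

lemma length_triangle {X A M C : D} {f : A ⟶ M} {g : M ⟶ C} {h : C ⟶ A⟦(1 : ℤ)⟧}
    (hT : Triangle.mk f g h ∈ distTriang D)
    (hA : IsFiniteLength R (X ⟶ A)) (hM : IsFiniteLength R (X ⟶ M))
    (hC : IsFiniteLength R (X ⟶ C)) :
    natLength R (X ⟶ A) + natLength R (X ⟶ C) = natLength R (X ⟶ M) +
      natLength R (LinearMap.ker (Linear.rightComp R X f)) +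
      natLength R (LinearMap.ker (Linear.rightComp R X (f⟦(1 : ℤ)⟧'))) := by
  have h₁ := natLength_eq_add hA (Linear.rightComp R X f)
  have h₂ := natLength_eq_add hM (Linear.rightComp R X g)
  have h₃ := natLength_eq_add hC (Linear.rightComp R X h)
  have e₁ : LinearMap.ker (Linear.rightComp R X g) = LinearMap.range (Linear.rightComp R X f) := by
    ext x
    simp only [LinearMap.mem_ker, LinearMap.mem_range, Linear.rightComp_apply]
    refine ⟨fun hx => ?_, ?_⟩
    · obtain ⟨y, hy⟩ := tri_to₂ hT x hx
      exact ⟨y, hy.symm⟩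
    · rintro ⟨y, rfl⟩
      rw [Category.assoc, tri_zero₁₂ hT, comp_zero]
  have e₂ : LinearMap.ker (Linear.rightComp R X h) = LinearMap.range (Linear.rightComp R X g) := by
    ext x
    simp only [LinearMap.mem_ker, LinearMap.mem_range, Linear.rightComp_apply]
    refine ⟨fun hx => ?_, ?_⟩
    · obtain ⟨y, hy⟩ := tri_to₃ hT x hx
      exact ⟨y, hy.symm⟩
    · rintro ⟨y, rfl⟩
      rw [Category.assoc, tri_zero₂₃ hT, comp_zero]
  have e₃ : LinearMap.ker (Linear.rightComp R X (f⟦(1 : ℤ)⟧')) =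
      LinearMap.range (Linear.rightComp R X h) := by
    ext x
    simp only [LinearMap.mem_ker, LinearMap.mem_range, Linear.rightComp_apply]
    refine ⟨fun hx => ?_, ?_⟩
    · obtain ⟨y, hy⟩ := tri_to₁ hT x hx
      exact ⟨y, hy.symm⟩
    · rintro ⟨y, rfl⟩
      rw [Category.assoc, tri_zero₃₁ hT, comp_zero]
  rw [e₁] at h₂
  rw [e₂] at h₃
  rw [e₃]
  omega

/-- The length of the kernel of `Hom(X, A⟦n⟧) → Hom(X, M⟦n⟧)`. -/
noncomputable def kerLength (X : D) {A M : D} (f : A ⟶ M) (n : ℤ) : ℕ :=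
  natLength R (LinearMap.ker (Linear.rightComp R X (f⟦n⟧')))

lemma ker_rightComp_units_smul (X : D) {A M : D} (f : A ⟶ M) (ε : ℤˣ) :
    LinearMap.ker (Linear.rightComp R X (ε • f)) = LinearMap.ker (Linear.rightComp R X f) := by
  ext x
  rcases Int.units_eq_one_or ε with rfl | rfl <;> simp

lemma kerLength_succ (X : D) {A M : D} (f : A ⟶ M) (n : ℤ) :
    natLength R (LinearMap.ker (Linear.rightComp R X (f⟦n⟧'⟦(1 : ℤ)⟧'))) =
      kerLength R X f (n + 1) := by
  let e (Y : D) : Y⟦n + 1⟧ ≅ Y⟦n⟧⟦(1 : ℤ)⟧ := (shiftFunctorAdd D n 1).app Y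
  have he : f⟦n⟧'⟦(1 : ℤ)⟧' = (e A).inv ≫ f⟦n + 1⟧' ≫ (e M).hom := by
    rw [Iso.eq_inv_comp]
    exact ((shiftFunctorAdd D n 1).hom.naturality f).symm
  have hker : ∀ x : X ⟶ A⟦n⟧⟦(1 : ℤ)⟧, x ≫ f⟦n⟧'⟦(1 : ℤ)⟧' = 0 ↔
      (x ≫ (e A).inv) ≫ f⟦n + 1⟧' = 0 := fun x => by
    rw [he, ← Category.assoc, ← Category.assoc]
    exact ⟨fun h => by rw [← cancel_mono (e M).hom, h, zero_comp], fun h => by rw [h, zero_comp]⟩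
  let φ : LinearMap.ker (Linear.rightComp R X (f⟦n⟧'⟦(1 : ℤ)⟧')) ≃ₗ[R]
      LinearMap.ker (Linear.rightComp R X (f⟦n + 1⟧')) :=
    { toFun := fun x => ⟨x.1 ≫ (e A).inv, (hker x.1).1 x.2⟩
      invFun := fun y => ⟨y.1 ≫ (e A).hom, (hker _).2 (by
        have := y.2
        simp only [LinearMap.mem_ker, Linear.rightComp_apply] at this
        simpa using this)⟩
      map_add' := fun x y => by ext; simp
      map_smul' := fun r x => by ext; simp
      left_inv := fun x => by ext; simp
      right_inv := fun x => by ext; simp }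
  unfold kerLength natLength
  rw [φ.length_eq]

/-- The Euler form. -/
noncomputable def euler (X Y : D) : ℚ := ∑ᶠ n : ℤ, (-1 : ℚ) ^ n * natLength R (X ⟶ Y⟦n⟧)

end Euler

/-- Additivity of a function on the triangles of `T₀`. -/
def AddFun (T₀ : D → Prop) (φ : D → ℚ) : Prop :=
  ∀ ⦃A M C : D⦄ (f : A ⟶ M) (g : M ⟶ C) (h : C ⟶ A⟦(1 : ℤ)⟧), Triangle.mk f g h ∈ distTriang D →
    T₀ A → T₀ C → φ M = φ A + φ C

namespace AddFun

open ZeroObject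

variable {T₀ : D → Prop} {φ : D → ℚ}

lemma zero (hφ : AddFun T₀ φ) (hT : Thick T₀) {Z : D} (hZ : IsZero Z) : φ Z = 0 := by
  have h : Triangle.mk (𝟙 Z) (𝟙 Z) (0 : Z ⟶ Z⟦(1 : ℤ)⟧) ∈ distTriang D :=
    isomorphic_distinguished _ (contractible_distinguished Z) _
      (Triangle.isoMk _ _ (Iso.refl Z) (Iso.refl Z) (hZ.iso (isZero_zero D)) (hZ.eq_of_src _ _)
        (hZ.eq_of_src _ _) (hZ.eq_of_src _ _))
  have := hφ _ _ _ h (hT.zero hZ) (hT.zero hZ)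
  linarith

lemma iso (hφ : AddFun T₀ φ) (hT : Thick T₀) {X Y : D} (hX : T₀ X) (e : X ≅ Y) : φ X = φ Y := by
  have h : Triangle.mk e.hom (0 : Y ⟶ 0) (0 : (0 : D) ⟶ X⟦(1 : ℤ)⟧) ∈ distTriang D :=
    isomorphic_distinguished _ (contractible_distinguished X) _
      (Triangle.isoMk _ _ (Iso.refl X) e.symm (Iso.refl (0 : D))
        (show e.hom ≫ e.inv = 𝟙 X ≫ 𝟙 X by simp)
        (show (0 : Y ⟶ 0) ≫ 𝟙 0 = e.inv ≫ 0 by simp)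
        (show (0 : (0 : D) ⟶ X⟦(1 : ℤ)⟧) ≫ (𝟙 X)⟦(1 : ℤ)⟧' = 𝟙 0 ≫ 0 by simp))
  have := hφ _ _ _ h hX (hT.zero (isZero_zero D))
  rw [this, hφ.zero hT (isZero_zero D), add_zero]

lemma shift_one (hφ : AddFun T₀ φ) (hT : Thick T₀) {X : D} (hX : T₀ X) :
    φ X + φ (X⟦(1 : ℤ)⟧) = 0 := by
  have h : Triangle.mk (0 : X ⟶ 0) (0 : 0 ⟶ X⟦(1 : ℤ)⟧) (-(𝟙 X)⟦(1 : ℤ)⟧') ∈ distTriang D :=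
    rot_of_distTriang _ (contractible_distinguished X)
  have := hφ _ _ _ h hX (hT.shift hX 1)
  rw [← this, hφ.zero hT (isZero_zero D)]

lemma shift (hφ : AddFun T₀ φ) (hT : Thick T₀) {X : D} (hX : T₀ X) (h0 : φ X = 0) (n : ℤ) :
    φ (X⟦n⟧) = 0 := by
  have key : ∀ m : ℤ, φ (X⟦m⟧) + φ (X⟦m + 1⟧) = 0 := fun m => by
    rw [hφ.iso hT (hT.shift hX (m + 1)) ((shiftFunctorAdd D m 1).app X)]
    exact hφ.shift_one hT (hT.shift hX m)
  induction n using Int.induction_on with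
  | zero => rw [hφ.iso hT (hT.shift hX 0) ((shiftFunctorZero D ℤ).app X)]; exact h0
  | succ i ih => linarith [key i]
  | pred i ih =>
    have := key (-(i : ℤ) - 1)
    rw [show -(i : ℤ) - 1 + 1 = -(i : ℤ) by ring] at this
    linarith

lemma rChain (hφ : AddFun T₀ φ) (hT : Thick T₀) {X Y L : D} (hX : T₀ X) (h0 : φ X = 0)
    (hY : T₀ Y) (c : RChain X Y L) : φ Y = φ L := by
  induction c with
  | refl => rfl
  | step h _ _ ih =>
    have h1 := hT.ext₃ h (hT.shift hX _) hY
    rw [hφ _ _ _ h (hT.shift hX _) h1, ih h1, hφ.shift hT hX h0, zero_add]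

end AddFun

namespace Setup

variable {R : Type w} [Ring R] [Linear R D] {T₀ H : D → Prop} (S : Setup R T₀ H)
include S

lemma hasFiniteSupport {X Y : D} (hX : T₀ X) (hY : T₀ Y) {a : ℤ → ℚ}
    (ha : ∀ n, Van X Y n → a n = 0) : Function.HasFiniteSupport a := by
  obtain ⟨N, hN⟩ := S.bdd hX hY
  refine (Set.finite_Icc (-N) N).subset fun n hn => ?_
  by_contra h
  refine hn (ha n (hN n ?_))
  rw [Set.mem_Icc, ← abs_le] at h
  omega

omit S in
lemma natLength_of_van {X Y : D} {n : ℤ} (h : Van X Y n) : natLength R (X ⟶ Y⟦n⟧) = 0 := by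
  have : Subsingleton (X ⟶ Y⟦n⟧) := ⟨fun a b => (h a).trans (h b).symm⟩
  exact natLength_eq_zero

omit S in
lemma kerLength_of_van {X A M : D} {f : A ⟶ M} {n : ℤ} (h : Van X A n) :
    kerLength R X f n = 0 := by
  have : Subsingleton (X ⟶ A⟦n⟧) := ⟨fun a b => (h a).trans (h b).symm⟩
  exact natLength_eq_zero

lemma addFun_euler {X : D} (hX : T₀ X) : AddFun T₀ (euler R X) := by
  intro A M C f g h hT hA hC
  have hM : T₀ M := S.thick.ext hT hA hC
  have key : ∀ n : ℤ, (-1 : ℚ) ^ n * natLength R (X ⟶ A⟦n⟧) +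
      (-1 : ℚ) ^ n * natLength R (X ⟶ C⟦n⟧) = ((-1 : ℚ) ^ n * natLength R (X ⟶ M⟦n⟧) +
      (-1 : ℚ) ^ n * kerLength R X f n) - (-1 : ℚ) ^ (n + 1) * kerLength R X f (n + 1) :=
      fun n => by
    have hT' : Triangle.mk (n.negOnePow • f⟦n⟧') (n.negOnePow • g⟦n⟧')
        (n.negOnePow • h⟦n⟧' ≫ (shiftFunctorComm D 1 n).hom.app A) ∈ distTriang D :=
      Triangle.shift_distinguished _ hT n
    have := length_triangle R (X := X) hT' (S.fin hX (S.thick.shift hA n))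
      (S.fin hX (S.thick.shift hM n)) (S.fin hX (S.thick.shift hC n))
    have h1 : (n.negOnePow • f⟦n⟧')⟦(1 : ℤ)⟧' = n.negOnePow • f⟦n⟧'⟦(1 : ℤ)⟧' := by
      rcases Int.units_eq_one_or n.negOnePow with h | h <;> rw [h] <;> simp
    rw [h1, ker_rightComp_units_smul, ker_rightComp_units_smul, kerLength_succ] at this
    have h2 : (natLength R (X ⟶ A⟦n⟧) : ℚ) + natLength R (X ⟶ C⟦n⟧) =
        natLength R (X ⟶ M⟦n⟧) + kerLength R X f n + kerLength R X f (n + 1) := by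
      exact_mod_cast this
    rw [zpow_add_one₀ (by norm_num)]
    linear_combination (-1 : ℚ) ^ n * h2
  have fA := S.hasFiniteSupport hX hA (a := fun n => (-1 : ℚ) ^ n * natLength R (X ⟶ A⟦n⟧))
    fun n hn => by simp [natLength_of_van hn]
  have fC := S.hasFiniteSupport hX hC (a := fun n => (-1 : ℚ) ^ n * natLength R (X ⟶ C⟦n⟧))
    fun n hn => by simp [natLength_of_van hn]
  have fM := S.hasFiniteSupport hX hM (a := fun n => (-1 : ℚ) ^ n * natLength R (X ⟶ M⟦n⟧))
    fun n hn => by simp [natLength_of_van hn]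
  have fK := S.hasFiniteSupport hX hA (a := fun n => (-1 : ℚ) ^ n * kerLength R X f n)
    fun n hn => by simp [kerLength_of_van hn]
  have fK' := S.hasFiniteSupport hX (S.thick.shift hA 1)
    (a := fun n => (-1 : ℚ) ^ (n + 1) * kerLength R X f (n + 1))
    fun n hn => by
      rw [van_shift_right] at hn
      simp [kerLength_of_van (add_comm 1 n ▸ hn)]
  have fMK : Function.HasFiniteSupport fun n => (-1 : ℚ) ^ n * natLength R (X ⟶ M⟦n⟧) +
      (-1 : ℚ) ^ n * kerLength R X f n := fM.add fK
  have e := finsum_congr key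
  rw [finsum_add_distrib fA fC, finsum_sub_distrib fMK fK', finsum_add_distrib fM fK] at e
  have e' : ∑ᶠ n : ℤ, (-1 : ℚ) ^ (n + 1) * kerLength R X f (n + 1) =
      ∑ᶠ n : ℤ, (-1 : ℚ) ^ n * kerLength R X f n :=
    finsum_comp_equiv (Equiv.addRight (1 : ℤ)) (f := fun n => (-1 : ℚ) ^ n * kerLength R X f n)
  rw [e'] at e
  change euler R X A + euler R X C = euler R X M + _ - _ at e
  linarith

omit S in
lemma euler_of_orth {X Y : D} (h : Orth X Y) : euler R X Y = 0 := by
  unfold euler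
  simp [natLength_of_van (h _)]

lemma euler_self {X : D} (hTX : T₀ X) (hX : Exc X) : euler R X X ≠ 0 := by
  unfold euler
  rw [finsum_eq_single _ 0 fun n hn => by simp [natLength_of_van (hX.van n hn)]]
  have := natLength_pos (S.fin hTX (S.thick.shift hTX 0)) (by
    by_contra h
    push Not at h
    exact hX.ne (isZero_of_van h))
  simp only [zpow_zero, one_mul]
  exact_mod_cast this.ne'

lemma exists_generators {T : D → Prop} (hF : Full T) (hT : Thick T) (hT₀ : ∀ Y, T Y → T₀ Y) :
    ∃ l : List D, ∀ φ : D → ℚ, AddFun T₀ φ → (∀ b ∈ l, φ b = 0) → ∀ Y, T Y → φ Y = 0 := by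
  induction hF with
  | zero T h => exact ⟨[], fun φ hφ _ Y hY => hφ.zero S.thick (h Y hY)⟩
  | step T X hX hTX _ ih =>
    obtain ⟨l, hl⟩ := ih (hT.rPerp X) fun Y hY => hT₀ Y hY.1
    refine ⟨X :: l, fun φ hφ h0 Y hY => ?_⟩
    obtain ⟨L, hL, hL'⟩ := S.exists_rChain (hT₀ X hTX) hX (hT₀ Y hY)
    rw [hφ.rChain S.thick (hT₀ X hTX) (h0 X (by simp)) (hT₀ Y hY) hL]
    exact hl φ hφ (fun b hb => h0 b (by simp [hb])) L ⟨hL.mem hT hTX hY, hL'⟩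

lemma exists_rk {T : D → Prop} (hF : Full T) (hT : Thick T) (hT₀ : ∀ Y, T Y → T₀ Y) :
    ∃ n, Rk n T := by
  obtain ⟨l, hl⟩ := S.exists_generators hF hT hT₀
  refine ⟨l.length, fun E hE hE' => ?_⟩
  let v : Fin E.length → Fin l.length → ℚ := fun i b => euler R (E.get i) (l.get b)
  have hv : LinearIndependent ℚ v := by
    rw [Fintype.linearIndependent_iff]
    intro c hc
    have hadd : AddFun T₀ fun Y => ∑ i, c i * euler R (E.get i) Y := by
      intro A M C f g h hT' hA hC
      change ∑ i, _ = ∑ i, _ + ∑ i, _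
      rw [← Finset.sum_add_distrib]
      refine Finset.sum_congr rfl fun i _ => ?_
      rw [S.addFun_euler (hT₀ _ (hE _ (E.get_mem i)).2) f g h hT' hA hC, mul_add]
    have hz := hl _ hadd fun b hb => by
      obtain ⟨j, rfl⟩ := List.get_of_mem hb
      simpa [v] using congrFun hc j
    have hj : ∀ m : ℕ, ∀ j : Fin E.length, E.length - j ≤ m → c j = 0 := by
      intro m
      induction m with
      | zero => intro j hj; have := j.2; omega
      | succ m ih =>
        intro j hj
        have h1 := hz _ (hE _ (E.get_mem j)).2
        rw [Finset.sum_eq_single j] at h1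
        · exact (mul_eq_zero.1 h1).resolve_right
            (S.euler_self (hT₀ _ (hE _ (E.get_mem j)).2) (hE _ (E.get_mem j)).1)
        · intro i _ hij
          rcases lt_or_gt_of_ne hij with h | h
          · rw [euler_of_orth (List.pairwise_iff_get.1 hE' i j h), mul_zero]
          · rw [ih i (by have := i.2; have : (j : ℕ) < i := h; omega), zero_mul]
        · simp
    exact fun i => hj _ i le_rfl
  simpa using hv.fintype_card_le_finrank

end Setup

namespace Setup

variable {R : Type w} [Ring R] [Linear R D] {T₀ H : D → Prop} (S : Setup R T₀ H)
include S

/-- The replacement of a Serre functor on an exceptional object. -/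
lemma exists_serre {F : D → Prop} (hF : Full F) {T : D → Prop} (hT : Thick T)
    (hT₀ : ∀ Y, T Y → T₀ Y) {B : D} (hB : Exc B) (hTB : T B) (h : ∀ Y, F Y ↔ RPerp T B Y) :
    ∃ S, Exc S ∧ T S ∧ (∀ M, T M → ∀ j : ℤ, Van M S (-j) → Van B M j) ∧
      ∀ M, T M → Orth B M → Orth M S := by
  induction hF generalizing T B with
  | zero F hF =>
    refine ⟨B, hB, hTB, fun M hM j hj => ?_, fun M hM hBM n =>
      van_of_isZero_left (hF M ((h M).2 ⟨hM, hBM⟩)) n⟩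
    obtain ⟨L, hL, hL'⟩ := S.exists_lChain (hT₀ B hTB) hB (hT₀ M hM)
    have hTL : T L := hL.mem hT hTB hM
    have hz : IsZero L := by
      obtain ⟨L', hc, hc'⟩ := S.exists_rChain (hT₀ B hTB) hB (hT₀ L hTL)
      exact isZero_of_van (hc.van_to' hB (fun d _ => hL' _) (van_of_isZero_right
        (hF L' ((h L').2 ⟨hc.mem hT hTB hTL, hc'⟩)) 0))
    refine hL.van_to' hB (fun d hd => hB.van _ fun h0 => hd ?_) (van_of_isZero_right hz j)
    rwa [show d = -j by omega]
  | step F X hX hFX _ ih =>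
    obtain ⟨hTX, hBX⟩ := (h X).1 hFX
    obtain ⟨B₁, hc, hc'⟩ := S.exists_rChain (hT₀ X hTX) hX (hT₀ B hTB)
    obtain ⟨E, hE, hTE, h1, h2⟩ := ih (hT.rPerp X) (fun Y hY => hT₀ Y hY.1)
      (hc.exc hX hB hBX hc') ⟨hc.mem hT hTX hTB, hc'⟩ fun Y => by
        refine Iff.trans (and_congr_left' (h Y)) ⟨fun hY => ⟨⟨hY.1.1, hY.2⟩, fun n => ?_⟩,
          fun hY => ⟨⟨hY.1.1, fun n => ?_⟩, hY.1.2⟩⟩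
        · exact hc.van_from hX (fun d _ => hY.2 _) (hY.1.2 n)
        · exact hc.van_from' hX (fun d _ => hY.1.2 _) (hY.2 n)
    refine ⟨E, hE, hTE.1, fun M hM j hj => ?_, fun M hM hBM n => ?_⟩
    · obtain ⟨M₁, hd, hd'⟩ := S.exists_rChain (hT₀ X hTX) hX (hT₀ M hM)
      have h3 := h1 M₁ ⟨hd.mem hT hTX hM, hd'⟩ j (hd.van_from hX (fun d _ => hTE.2 _) hj)
      exact hd.van_to' hX (fun d _ => hBX _) (hc.van_from' hX (fun d _ => hd' _) h3)
    · obtain ⟨M₁, hd, hd'⟩ := S.exists_rChain (hT₀ X hTX) hX (hT₀ M hM)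
      have h3 : Orth B M₁ := fun n => hd.van_to hX (fun d _ => hBX _) (hBM n)
      have h4 := h2 M₁ ⟨hd.mem hT hTX hM, hd'⟩
        fun n => hc.van_from hX (fun d _ => hd' _) (h3 n)
      exact hd.van_from' hX (fun d _ => hTE.2 _) (h4 n)

variable {n : ℕ} (hC : Complements T₀ n) {T : D → Prop} (hT : Thick T) (hT₀ : ∀ Y, T Y → T₀ Y)
  (hR : Rk (n + 1) T)
include hC hT hT₀ hR

lemma full_of_ext_left {X E : D} (hX : Exc X) (hE : Exc E) (hTX : T X) (hTE : T E)
    (hHX : H X) (hHE : H E) (h : Full (RPerp T X)) (hv : Van X E 1) : Full (RPerp T E) := by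
  have hXE : ∀ m : ℤ, m ≠ 0 → Van X E m := fun m hm => by
    by_cases h1 : m = 1
    · rw [h1]; exact hv
    · exact S.hered hHX hHE (by omega)
  obtain ⟨L, c, cL⟩ := S.exists_rChain (hT₀ X hTX) hX (hT₀ E hTE)
  have hd : ∀ d, ¬ Van X E d → d = 0 := fun d hd => by
    by_contra h0; exact hd (hXE d h0)
  have hTL := c.mem hT hTX hTE
  have hEL : ∀ m : ℤ, 0 < m → Van E L m := fun m hm =>
    c.van_to hX (fun d h' => by rw [hd d h']; exact S.hered hHE hHX (by omega)) (hE.van _ hm.ne')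
  have hLL : ∀ m : ℤ, 0 < m → Van L L m := fun m hm =>
    c.van_from hX (fun d _ => cL _) (hEL m hm)
  have hLX : ∀ m : ℤ, 2 ≤ m → Van L X m := fun m hm =>
    c.van_from hX (fun d h' => by rw [hd d h']; exact hX.van _ (by omega))
      (S.hered hHE hHX (by omega))
  have hW := S.rPerp_full hC (hT.rPerp X) (fun Y hY => hT₀ Y hY.1) (hR.rPerp hX hTX) h
    (V := L) ⟨hTL, cL⟩ hLL
  have hLE : ∀ m : ℤ, 2 ≤ m → Van L E m := fun m hm =>
    c.van_from hX (fun d h' => hXE _ (by rw [hd d h']; omega)) (hE.van _ (by omega))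
  have hTB : T (X ⊞ L⟦(-1 : ℤ)⟧) := hT.biprod hTX (hT.shift hTL _)
  have hBB : ∀ m : ℤ, 0 < m → Van (X ⊞ L⟦(-1 : ℤ)⟧) (X ⊞ L⟦(-1 : ℤ)⟧) m := fun m hm => by
    refine van_biprod_left (van_biprod_right (hX.van _ hm.ne')
      ((van_shift_right _ _).2 (cL _))) (van_biprod_right ?_ ?_)
    · exact (van_shift_left _ _).2 (hLX _ (by omega))
    · exact (van_shift_left _ _).2 ((van_shift_right _ _).2 (hLL _ (by omega)))
  have hBE : ∀ m : ℤ, 0 < m → Van (X ⊞ L⟦(-1 : ℤ)⟧) E m := fun m hm =>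
    van_biprod_left (hXE m hm.ne') ((van_shift_left _ _).2 (hLE _ (by omega)))
  have hEB : ∀ m : ℤ, 2 ≤ m → Van E (X ⊞ L⟦(-1 : ℤ)⟧) m := fun m hm =>
    van_biprod_right (S.hered hHE hHX (by omega)) ((van_shift_right _ _).2 (hEL _ (by omega)))
  obtain ⟨V, cV, cV'⟩ := S.exists_rChain (hT₀ E hTE) hE (hT₀ _ hTB)
  have hVV : ∀ m : ℤ, 0 < m → Van V V m := fun m hm =>
    cV.van_from hE (fun d _ => cV' _) (cV.van_to hE (fun d h' => by
      have : d < 2 := by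
        by_contra h''
        exact h' (hEB d (by omega))
      exact hBE _ (by omega)) (hBB m hm))
  refine S.full_of_rPerp (hT.rPerp E) (fun Y hY => hT₀ Y hY.1) (V := V)
    ⟨cV.mem hT hTE hTB, cV'⟩ hVV (hW.congr fun Y => ?_)
  constructor
  · rintro ⟨⟨hY, hXY⟩, hLY⟩
    have hEY : Orth E Y := fun m => c.van_from' hX (fun d _ => hXY _) (hLY m)
    exact ⟨⟨hY, hEY⟩, fun m => cV.van_from hE (fun d _ => hEY _)
      (van_biprod_left (hXY m) ((van_shift_left _ _).2 (hLY _)))⟩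
  · rintro ⟨⟨hY, hEY⟩, hVY⟩
    have hBY : Orth (X ⊞ L⟦(-1 : ℤ)⟧) Y := fun m => cV.van_from' hE (fun d _ => hEY _) (hVY m)
    exact ⟨⟨hY, (thick_orth_left Y).fst hBY⟩,
      ((thick_orth_left Y).shift_iff _).1 ((thick_orth_left Y).snd hBY)⟩

lemma full_of_ext_right {X E : D} (hX : Exc X) (hE : Exc E) (hTX : T X) (hTE : T E)
    (hHX : H X) (hHE : H E) (h : Full (RPerp T X)) (hv : Van E X 1) : Full (RPerp T E) := by
  have hEX : ∀ m : ℤ, m ≠ 0 → Van E X m := fun m hm => by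
    by_cases h1 : m = 1
    · rw [h1]; exact hv
    · exact S.hered hHE hHX (by omega)
  obtain ⟨L, c, cL⟩ := S.exists_lChain (hT₀ X hTX) hX (hT₀ E hTE)
  have hd : ∀ d, ¬ Van E X d → d = 0 := fun d hd => by
    by_contra h0; exact hd (hEX d h0)
  have hTL := c.mem hT hTX hTE
  have hLE : ∀ m : ℤ, 0 < m → Van L E m := fun m hm =>
    c.van_from hX (fun d h' => by rw [hd d h']; exact S.hered hHX hHE (by omega)) (hE.van _ hm.ne')
  have hLL : ∀ m : ℤ, 0 < m → Van L L m := fun m hm =>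
    c.van_to hX (fun d _ => cL _) (hLE m hm)
  have hXL : ∀ m : ℤ, 2 ≤ m → Van X L m := fun m hm =>
    c.van_to hX (fun d h' => by rw [hd d h']; exact hX.van _ (by omega))
      (S.hered hHX hHE (by omega))
  have hW := S.lPerp_full hC (hT.lPerp X) (fun Y hY => hT₀ Y hY.1) (hR.lPerp hX hTX)
    ((S.transfer hT hT₀ hX hTX).1 h) (V := L) ⟨hTL, cL⟩ hLL
  have hEL : ∀ m : ℤ, 2 ≤ m → Van E L m := fun m hm =>
    c.van_to hX (fun d h' => hEX _ (by rw [hd d h']; omega)) (hE.van _ (by omega))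
  have hTB : T (X ⊞ L⟦(1 : ℤ)⟧) := hT.biprod hTX (hT.shift hTL _)
  have hBB : ∀ m : ℤ, 0 < m → Van (X ⊞ L⟦(1 : ℤ)⟧) (X ⊞ L⟦(1 : ℤ)⟧) m := fun m hm => by
    refine van_biprod_left (van_biprod_right (hX.van _ hm.ne')
      ((van_shift_right _ _).2 (hXL _ (by omega)))) (van_biprod_right ?_ ?_)
    · exact (van_shift_left _ _).2 (cL _)
    · exact (van_shift_left _ _).2 ((van_shift_right _ _).2 (hLL _ (by omega)))
  have hEB : ∀ m : ℤ, 0 < m → Van E (X ⊞ L⟦(1 : ℤ)⟧) m := fun m hm =>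
    van_biprod_right (hEX m hm.ne') ((van_shift_right _ _).2 (hEL _ (by omega)))
  have hBE : ∀ m : ℤ, 2 ≤ m → Van (X ⊞ L⟦(1 : ℤ)⟧) E m := fun m hm =>
    van_biprod_left (S.hered hHX hHE (by omega)) ((van_shift_left _ _).2 (hLE _ (by omega)))
  obtain ⟨V, cV, cV'⟩ := S.exists_lChain (hT₀ E hTE) hE (hT₀ _ hTB)
  have hVV : ∀ m : ℤ, 0 < m → Van V V m := fun m hm =>
    cV.van_to hE (fun d _ => cV' _) (cV.van_from hE (fun d h' => by
      have : d < 2 := by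
        by_contra h''
        exact h' (hBE d (by omega))
      exact hEB _ (by omega)) (hBB m hm))
  refine (S.transfer hT hT₀ hE hTE).2 (S.full_of_lPerp (hT.lPerp E) (fun Y hY => hT₀ Y hY.1)
    (V := V) ⟨cV.mem hT hTE hTB, cV'⟩ hVV (hW.congr fun Y => ?_))
  constructor
  · rintro ⟨⟨hY, hYX⟩, hYL⟩
    have hYE : Orth Y E := fun m => c.van_to' hX (fun d _ => hYX _) (hYL m)
    exact ⟨⟨hY, hYE⟩, fun m => cV.van_to hE (fun d _ => hYE _)
      (van_biprod_right (hYX m) ((van_shift_right _ _).2 (hYL _)))⟩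
  · rintro ⟨⟨hY, hYE⟩, hYV⟩
    have hYB : Orth Y (X ⊞ L⟦(1 : ℤ)⟧) := fun m => cV.van_to' hE (fun d _ => hYE _) (hYV m)
    exact ⟨⟨hY, (thick_orth_right Y).fst hYB⟩,
      ((thick_orth_right Y).shift_iff _).1 ((thick_orth_right Y).snd hYB)⟩

end Setup

/-- `A` is a finite power of `X`. -/
inductive Pow (X : D) : D → Prop
  | zero {A : D} (hA : IsZero A) : Pow X A
  | cons {A : D} (hA : Pow X A) : Pow X (X ⊞ A)

lemma Pow.mem {X A : D} (h : Pow X A) {T : D → Prop} (h0 : ∀ {Z}, IsZero Z → T Z) (hX : T X)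
    (hb : ∀ {Y Z}, T Y → T Z → T (Y ⊞ Z)) : T A := by
  induction h with
  | zero hA => exact h0 hA
  | cons _ ih => exact hb hX ih

lemma Pow.van_left {X A Y : D} {n : ℤ} (h : Pow X A) (hX : Van X Y n) : Van A Y n :=
  h.mem (T := fun A => Van A Y n) (fun hz => van_of_isZero_left hz n) hX
    fun hY hZ => van_biprod_left hY hZ

lemma Pow.van_right {X A Y : D} {n : ℤ} (h : Pow X A) (hX : Van Y X n) : Van Y A n :=
  h.mem (T := fun A => Van Y A n) (fun hz => van_of_isZero_right hz n) hX
    fun hY hZ => van_biprod_right hY hZ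

lemma Pow.factor_left {X A E : D} (h : Pow X A) {A₀ : D} {f : E ⟶ A₀}
    (hf : ∀ g : E ⟶ X, ∃ w, g = f ≫ w) (g : E ⟶ A) : ∃ w, g = f ≫ w := by
  induction h with
  | zero hA => exact ⟨0, hA.eq_of_tgt _ _⟩
  | cons _ ih =>
    obtain ⟨w₁, h₁⟩ := hf (g ≫ biprod.fst)
    obtain ⟨w₂, h₂⟩ := ih (g ≫ biprod.snd)
    refine ⟨biprod.lift w₁ w₂, ?_⟩
    apply biprod.hom_ext <;> simp [h₁, h₂]

section Approx

variable (R : Type w) [Ring R] [Linear R D]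

lemma exists_left_approx_list {X E : D} (s : List (E ⟶ X)) : ∃ (A : D) (f : E ⟶ A), Pow X A ∧
    ∀ g ∈ s, ∃ w, g = f ≫ w := by
  induction s with
  | nil => exact ⟨_, 0, .zero (isZero_zero D), by simp⟩
  | cons a s ih =>
    obtain ⟨A, f, hA, hf⟩ := ih
    refine ⟨X ⊞ A, biprod.lift a f, hA.cons, fun g hg => ?_⟩
    rcases List.mem_cons.1 hg with rfl | hg
    · exact ⟨biprod.fst, by simp⟩
    · obtain ⟨w, hw⟩ := hf g hg
      exact ⟨biprod.snd ≫ w, by simpa using hw⟩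

lemma exists_right_approx_list {X E : D} (s : List (X ⟶ E)) : ∃ (A : D) (f : A ⟶ E), Pow X A ∧
    ∀ g ∈ s, ∃ w, g = w ≫ f := by
  induction s with
  | nil => exact ⟨_, 0, .zero (isZero_zero D), by simp⟩
  | cons a s ih =>
    obtain ⟨A, f, hA, hf⟩ := ih
    refine ⟨X ⊞ A, biprod.desc a f, hA.cons, fun g hg => ?_⟩
    rcases List.mem_cons.1 hg with rfl | hg
    · exact ⟨biprod.inl, by simp⟩
    · obtain ⟨w, hw⟩ := hf g hg
      exact ⟨w ≫ biprod.inr, by simpa using hw⟩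

lemma exists_left_approx {X E : D} (h : IsFiniteLength R (E ⟶ X)) :
    ∃ (A : D) (f : E ⟶ A), Pow X A ∧ ∀ g : E ⟶ X, ∃ w, g = f ≫ w := by
  have := (isFiniteLength_iff_isNoetherian_isArtinian.1 h).1
  obtain ⟨s, hs⟩ : (⊤ : Submodule R (E ⟶ X)).FG := IsNoetherian.noetherian _
  obtain ⟨A, f, hA, hf⟩ := exists_left_approx_list s.toList
  refine ⟨A, f, hA, fun g => ?_⟩
  have hle : Submodule.span R (s : Set (E ⟶ X)) ≤ LinearMap.range (Linear.leftComp R X f) := by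
    rw [Submodule.span_le]
    intro g hg
    obtain ⟨w, hw⟩ := hf g (by simpa using hg)
    exact ⟨w, hw.symm⟩
  rw [hs] at hle
  obtain ⟨w, hw⟩ := hle (Submodule.mem_top (x := g))
  exact ⟨w, hw.symm⟩

lemma exists_right_approx {X E : D} (h : IsFiniteLength R (X ⟶ E)) :
    ∃ (A : D) (f : A ⟶ E), Pow X A ∧ ∀ g : X ⟶ E, ∃ w, g = w ≫ f := by
  have := (isFiniteLength_iff_isNoetherian_isArtinian.1 h).1
  obtain ⟨s, hs⟩ : (⊤ : Submodule R (X ⟶ E)).FG := IsNoetherian.noetherian _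
  obtain ⟨A, f, hA, hf⟩ := exists_right_approx_list s.toList
  refine ⟨A, f, hA, fun g => ?_⟩
  have hle : Submodule.span R (s : Set (X ⟶ E)) ≤ LinearMap.range (Linear.rightComp R X f) := by
    rw [Submodule.span_le]
    intro g hg
    obtain ⟨w, hw⟩ := hf g (by simpa using hg)
    exact ⟨w, hw.symm⟩
  rw [hs] at hle
  obtain ⟨w, hw⟩ := hle (Submodule.mem_top (x := g))
  exact ⟨w, hw.symm⟩

end Approx

lemma exists_component {E : D} {l : List (D × ℤ)} {q : E ⟶ sumList l} (hq : q ≠ 0) :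
    ∃ p ∈ l, ¬ Van E p.1 p.2 := by
  by_contra h
  push Not at h
  refine hq ?_
  clear hq
  induction l with
  | nil => exact isZero_sumList_nil.eq_of_tgt _ _
  | cons p l ih =>
    apply biprod.hom_ext
    · exact Eq.trans (h p (by simp) _) zero_comp.symm
    · exact Eq.trans (ih (q := q ≫ biprod.snd) fun p' hp' => h p' (by simp [hp'])) zero_comp.symm

lemma tri_from₁ {A M C : D} {f : A ⟶ M} {g : M ⟶ C} {h : C ⟶ A⟦(1 : ℤ)⟧}
    (hT : Triangle.mk f g h ∈ distTriang D) {Y : D} (x : A ⟶ Y) (hx : h ≫ x⟦(1 : ℤ)⟧' = 0) :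
    ∃ y, x = f ≫ y := by
  obtain ⟨y, hy⟩ : ∃ y : M⟦(1 : ℤ)⟧ ⟶ Y⟦(1 : ℤ)⟧, x⟦(1 : ℤ)⟧' = (-f⟦(1 : ℤ)⟧') ≫ y :=
    Triangle.yoneda_exact₂ _ (rot_of_distTriang _ (rot_of_distTriang _ hT)) (x⟦(1 : ℤ)⟧') hx
  obtain ⟨z, rfl⟩ := (shiftFunctor D (1 : ℤ)).map_surjective y
  refine ⟨-z, (shiftFunctor D (1 : ℤ)).map_injective ?_⟩
  rw [hy]; simp

namespace Setup

variable {R : Type w} [Ring R] [Linear R D] {T₀ H : D → Prop} (S : Setup R T₀ H)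
include S

/-- An object interpolating between `E` and `X`. -/
lemma exists_image {X E : D} (hHX : H X) (hHE : H E) (hX : Exc X) (hE : Exc E)
    (h : ¬ Van E X 0) : ∃ Y, H Y ∧ Exc Y ∧ Van Y X 1 ∧ Van E Y 1 ∧
      ∀ T : D → Prop, Thick T → T X → T E → T Y := by
  obtain ⟨A, f, hA, hf⟩ := exists_left_approx R (S.fin (S.H_le hHE) (S.H_le hHX))
  have hHA : H A := hA.mem S.H_zero hHX S.H_biprod
  have hf0 : f ≠ 0 := by
    rintro rfl
    refine h (van_zero.2 fun g => ?_)
    obtain ⟨w, rfl⟩ := hf g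
    rw [zero_comp]
  obtain ⟨C₀, C₁, c, d, hC₀, hC₁, hT⟩ := S.exists_cone_H hHE hHA f
  obtain ⟨I, i, δ, hI⟩ := exists_fiber (c ≫ biprod.fst)
  obtain ⟨q, hq, hqδ⟩ : ∃ q : E ⟶ I, f = q ≫ i ∧ d ≫ q⟦(1 : ℤ)⟧' = biprod.fst ≫ δ := by
    obtain ⟨q, h1, h2⟩ := complete_distinguished_triangle_morphism₁ _ _ hT hI (𝟙 A) biprod.fst
      (Category.id_comp _).symm
    exact ⟨q, (Category.comp_id f).symm.trans h1, h2⟩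
  have hinl : ∀ {Z : D} (z : Z ⟶ C₀), z ≫ δ = (z ≫ biprod.inl ≫ d) ≫ q⟦(1 : ℤ)⟧' :=
    fun z => by simp only [Category.assoc, hqδ]; simp
  have hIX : Van I X 1 := van_tri₁' hI (S.hered hC₀ hHX (by omega))
      (hA.van_left (hX.van 1 (by omega)))
  have hEI : Van E I 1 := fun x => by
    have hxi : x ≫ i⟦(1 : ℤ)⟧' = 0 := by
      let e : E⟦(-1 : ℤ)⟧⟦(1 : ℤ)⟧ ≅ E := (shiftFunctorCompIsoId D (-1) 1 (by omega)).app E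
      obtain ⟨t, ht⟩ := (shiftFunctor D (1 : ℤ)).map_surjective (e.hom ≫ x)
      have h1 : t ≫ i = 0 := by
        have h2 : (t ≫ i) ≫ c = 0 := by
          apply biprod.hom_ext
          · rw [zero_comp, Category.assoc, Category.assoc, tri_zero₁₂ hI, comp_zero]
          · rw [zero_comp]
            exact (noHom_shift_left (-1)).2 ((van_shift_right _ _).2
              (S.hered hHE hC₁ (by omega))) _
        obtain ⟨y, hy⟩ := tri_to₂ hT _ h2
        rw [hy, (noHom_shift_left (-1)).2 (hE.van _ (by omega)) y, zero_comp]
      rw [← cancel_epi e.hom, ← Category.assoc, ← ht, ← CategoryTheory.Functor.map_comp, h1,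
        Functor.map_zero, comp_zero]
    obtain ⟨z, rfl⟩ := tri_to₁ hI x hxi
    rw [hinl, hE.van 1 (by omega) (z ≫ biprod.inl ≫ d), zero_comp]
  have hepi : ∀ {Z : D}, H Z → ∀ t : I ⟶ Z, q ≫ t = 0 → t = 0 := fun {Z} hZ t ht => by
    obtain ⟨t', rfl⟩ := tri_from₁ hI t (by
      have := hinl (𝟙 C₀)
      rw [Category.id_comp, Category.id_comp] at this
      rw [this, Category.assoc, ← CategoryTheory.Functor.map_comp, ht, Functor.map_zero, comp_zero])
    obtain ⟨t'', rfl⟩ := tri_from₂ hT t' (by rw [hq, Category.assoc]; exact ht)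
    have h1 : t'' = biprod.fst ≫ biprod.inl ≫ t'' := by
      apply biprod.hom_ext'
      · simp
      · rw [S.noHom_neg hC₁ hZ (biprod.inr ≫ t'')]; simp
    rw [h1, ← Category.assoc c, ← Category.assoc i, tri_zero₁₂ hI, zero_comp]
  have hII : Van I I 1 := fun x => by
    obtain ⟨u, rfl⟩ := tri_to₁ hI x (hA.van_right hIX _)
    obtain ⟨v, hv⟩ := tri_to₃ hI (q ≫ u) (by rw [Category.assoc]; exact hEI _)
    obtain ⟨w, rfl⟩ := hA.factor_left hf v
    have h1 := hepi hC₀ (u - i ≫ w ≫ c ≫ biprod.fst) (by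
      rw [Preadditive.comp_sub, hv, hq]; simp)
    rw [sub_eq_zero.1 h1]
    simp only [Category.assoc]
    have := tri_zero₂₃ hI
    rw [Category.assoc] at this
    rw [this, comp_zero, comp_zero]
  have hTI : ∀ T : D → Prop, Thick T → T X → T E → T I := fun T hTh hTX hTE => by
    have hTA : T A := hA.mem hTh.zero hTX hTh.biprod
    exact hTh.ext₁ hI hTA (hTh.fst (hTh.ext₃ hT hTE hTA))
  obtain ⟨l, hl, ⟨e⟩⟩ := S.split (hTI T₀ S.thick (S.H_le hHX) (S.H_le hHE))
  obtain ⟨⟨M, s⟩, hp, hp'⟩ := exists_component (q := q ≫ e.hom) fun h0 => hf0 (by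
    have : q = 0 := by rw [← cancel_mono e.hom, h0, zero_comp]
    rw [hq, this, zero_comp])
  have hM := hl _ hp
  have hr : Retr (M⟦s⟧) I := (retr_sumList hp).trans (Retr.of_iso e.symm)
  simp only at hp' hM
  have hs : s = 0 := by
    by_contra hs0
    have hs1 : s = 1 := by
      by_contra hs1
      exact hp' (S.hered hHE hM (by omega))
    subst hs1
    have h1 : Van (M⟦(1 : ℤ)⟧) I 0 := van_tri₁ hI
      ((van_shift_left _ _).2 (S.hered hM hC₀ (by omega)))
      ((van_shift_left _ _).2 (S.hered hM hHA (by omega)))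
    exact hp' (van_of_isZero_right ((isZero_shift_iff 1).1 (isZero_of_van (hr.van_right h1))) _)
  subst hs
  replace hr : Retr M I := (Retr.of_iso ((shiftFunctorZero D ℤ).app M).symm).trans hr
  obtain ⟨l', hl', hl''⟩ := S.ind_decomp hM
  obtain ⟨Y, hY⟩ : ∃ Y, Y ∈ l' := by
    by_contra hno
    push Not at hno
    exact hp' (hl'' _ (thick_orth_right E) (fun a ha => (hno a ha).elim) 0)
  obtain ⟨hHY, hYI, hYM⟩ := hl' Y hY
  have hYI' := hYM.trans hr
  exact ⟨Y, hHY, S.exc_of_ind hHY hYI (hYI'.van_left (hYI'.van_right hII)), hYI'.van_left hIX,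
    hYI'.van_right hEI, fun T hTh hTX hTE => hYI'.mem hTh (hTI T hTh hTX hTE)⟩

variable {n : ℕ} (hC : Complements T₀ n) {T : D → Prop} (hT : Thick T) (hT₀ : ∀ Y, T Y → T₀ Y)
  (hR : Rk (n + 1) T)
include hC hT hT₀ hR

lemma full_of_hom {X E : D} (hX : Exc X) (hE : Exc E) (hTX : T X) (hTE : T E)
    (hHX : H X) (hHE : H E) (h : Full (RPerp T X)) (hv : ¬ Van E X 0) : Full (RPerp T E) := by
  obtain ⟨Y, hHY, hY, hYX, hEY, hTY⟩ := S.exists_image hHX hHE hX hE hv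
  have hTY' := hTY T hT hTX hTE
  exact S.full_of_ext_right hC hT hT₀ hR hY hE hTY' hTE hHY hHE
    (S.full_of_ext_right hC hT hT₀ hR hX hY hTX hTY' hHX hHY h hYX) hEY

omit S hC hT hT₀ hR in
lemma rPerp_shift_iff {X X' : D} {s : ℤ} (e : X ≅ X'⟦s⟧) (Y : D) :
    RPerp T X Y ↔ RPerp T X' Y :=
  and_congr_right fun _ => ⟨fun h => ((thick_orth_left Y).shift_iff s).1
    ((thick_orth_left Y).iso e h), fun h => (thick_orth_left Y).iso e.symm
    ((thick_orth_left Y).shift h s)⟩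

lemma full_rPerp_of_heart (hF : Full T) {E : D} (hE : Exc E) (hTE : T E) (hHE : H E) :
    Full (RPerp T E) := by
  rcases hF with ⟨_, h⟩ | ⟨_, B', hB', hTB', h⟩
  · exact (hE.ne (h E hTE)).elim
  obtain ⟨B, b, hHB, hB, ⟨eB⟩⟩ := S.exists_heart (hT₀ B' hTB') hB'
  have hTB : T B := (hT.shift_iff b).1 (hT.iso eB hTB')
  replace h : Full (RPerp T B) := h.congr (rPerp_shift_iff eB)
  by_cases hv : Van B E 1
  · exact S.full_of_ext_left hC hT hT₀ hR hB hE hTB hTE hHB hHE h hv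
  obtain ⟨N', hN', hTN', h1, h2⟩ := S.exists_serre h hT hT₀ hB hTB fun _ => Iff.rfl
  obtain ⟨X, s, hHX, hX, ⟨e⟩⟩ := S.exists_heart (hT₀ N' hTN') hN'
  have hTX : T X := (hT.shift_iff s).1 (hT.iso e hTN')
  have hgood : Full (RPerp T X) := by
    refine ((S.transfer hT hT₀ hN' hTN').2 (h.congr fun Y => ⟨fun hY => ⟨hY.1, h2 Y hY.1 hY.2⟩,
      fun hY => ⟨hY.1, fun n => h1 Y hY.1 n (hY.2 _)⟩⟩)).congr (rPerp_shift_iff e)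
  have hEX : ¬ Van E X (s - 1) := fun h3 => hv (h1 E hTE 1 ((van_iso_right e).2
    ((van_shift_right _ _).2 (by rwa [show s + -1 = s - 1 by ring]))))
  have hBX : ¬ Van B X s := fun h3 => hB.ne (isZero_of_van (h1 B hTB 0 ((van_iso_right e).2
    ((van_shift_right _ _).2 (by rwa [show s + -0 = s by ring])))))
  have hs : s = 1 := by
    have h3 : 0 ≤ s - 1 := by
      by_contra h4; exact hEX (S.hered hHE hHX (by omega))
    have h4 : s < 2 := by
      by_contra h4; exact hBX (S.hered hHB hHX (by omega))
    omega
  subst hs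
  exact S.full_of_hom hC hT hT₀ hR hX hE hTX hTE hHX hHE hgood (by simpa using hEX)

omit hC hT hT₀ hR in
lemma complements (n : ℕ) : Complements T₀ n := by
  induction n with
  | zero =>
    intro T _ _ hR _ E hE hTE
    have := hR [E] (by simp [hE, hTE]) (by simp)
    simp at this
  | succ n ih =>
    intro T hT hT₀ hR hF E hE hTE
    obtain ⟨E', s, hHE, hE', ⟨e⟩⟩ := S.exists_heart (hT₀ E hTE) hE
    exact (S.full_rPerp_of_heart ih hT hT₀ hR hF hE' ((hT.shift_iff s).1 (hT.iso e hTE))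
      hHE).congr fun Y => (rPerp_shift_iff e Y).symm

end Setup

lemma AddOf.van {U V Y : D} {n : ℤ} (h : AddOf U V) (hU : Van U Y n) : Van V Y n := by
  induction h with
  | base => exact hU
  | zero Z hZ => exact van_of_isZero_left hZ n
  | biprod _ _ h₁ h₂ => exact van_biprod_left h₁ h₂
  | ofIso e _ h => exact (van_iso_left e).1 h
  | summandLeft _ h => exact h.of_retract_left biprod.inl biprod.fst (by simp)
  | summandRight _ h => exact h.of_retract_left biprod.inr biprod.snd (by simp)

lemma Ind.indec {X : D} (h : Ind X) : Indec X := by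
  refine ⟨h.1, fun Y Z ⟨e⟩ => ?_⟩
  by_contra! hYZ
  obtain ⟨hY, hZ⟩ := hYZ
  have h₁ := h.iso_of_retr hY (i := biprod.inl ≫ e.inv) (r := e.hom ≫ biprod.fst) (by simp)
  refine hZ (isZero_of_id_eq_zero ?_)
  calc 𝟙 Z = biprod.inr ≫ e.inv ≫ 𝟙 X ≫ e.hom ≫ biprod.snd := by simp
    _ = 0 := by rw [← h₁]; simp

lemma thick_van_uniform (U : D) : Thick fun V => ∃ N : ℤ, ∀ W : D,
    (∀ i : ℤ, 0 < i → Van U W i) → ∀ n, N ≤ n → Van V W n where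
  zero h := ⟨0, fun _ _ n _ => van_of_isZero_left h n⟩
  shift := fun ⟨N, hN⟩ a => ⟨N + a, fun W hW n hn =>
    (van_shift_left a n).2 (hN W hW _ (by omega))⟩
  ext hT := fun ⟨N₁, h₁⟩ ⟨N₂, h₂⟩ => ⟨max N₁ N₂, fun W hW n hn =>
    van_tri₂' hT (h₁ W hW n (by omega)) (h₂ W hW n (by omega))⟩
  retract i r hir := fun ⟨N, hN⟩ => ⟨N, fun W hW n hn => (hN W hW n hn).of_retract_left i r hir⟩

namespace Setup

variable {R : Type w} [Ring R] [Linear R D] {T₀ H : D → Prop} (S : Setup R T₀ H)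
include S

lemma mem_of_rPerpList {T T' : D → Prop} (hT : Thick T) (hT₀ : ∀ Y, T Y → T₀ Y)
    (hT' : Thick T') {l : List D} (hl : ∀ a ∈ l, Exc a ∧ T a ∧ T' a) (hl' : l.Pairwise Orth)
    (hz : ∀ Y, RPerpList T l Y → IsZero Y) {Y : D} (hY : T Y) : T' Y := by
  induction l generalizing T Y with
  | nil => exact hT'.zero (hz Y ⟨hY, by simp⟩)
  | cons a l ih =>
    obtain ⟨h1, h2⟩ := List.pairwise_cons.1 hl'
    obtain ⟨ha, hTa, hTa'⟩ := hl a (by simp)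
    obtain ⟨L, hL, hL'⟩ := S.exists_rChain (hT₀ a hTa) ha (hT₀ Y hY)
    refine hL.mem' hT' hTa' (ih (hT.rPerp a) (fun Y hY => hT₀ Y hY.1) (fun b hb => ?_) h2
      (fun Z hZ => hz Z ⟨hZ.1.1, ?_⟩) ⟨hL.mem hT hTa hY, hL'⟩)
    · have hb' := hl b (by simp [hb])
      exact ⟨hb'.1, ⟨hb'.2.1, h1 b hb⟩, hb'.2.2⟩
    · simpa using ⟨hZ.1.2, hZ.2⟩

/-- A generating presilting object forces maximal presilting objects to generate. -/
lemma generates_of_maximal {G : D} (hG : T₀ G) (hGG : ∀ i : ℤ, i ≠ 0 → Van G G i)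
    (hgen : ∀ Y, T₀ Y → Orth G Y → IsZero Y) {U : D} (hU : T₀ U)
    (hUU : ∀ i : ℤ, 0 < i → Van U U i)
    (hmax : ∀ V : D, T₀ V → Indec V → (∀ i : ℤ, 0 < i → Van (U ⊞ V) (U ⊞ V) i) → AddOf U V)
    {X : D} (hX : T₀ X) : IsThickOf D U X := by
  have hF : Full T₀ := S.full_of_rPerp S.thick (fun _ h => h) hG (fun i hi => hGG i hi.ne')
    (.zero _ fun Y hY => hgen Y hY.1 hY.2)
  obtain ⟨n, hR⟩ := S.exists_rk hF S.thick fun _ h => h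
  have hFU := S.rPerp_full (S.complements n) S.thick (fun _ h => h) hR hF hU hUU
  obtain ⟨l, hl, hl', hlU, -, hlT⟩ := S.exists_list S.thick (fun _ h => h) hU hUU
  rcases hFU with ⟨_, h⟩ | ⟨_, E, hE, ⟨hTE, hUE⟩, -⟩
  · exact S.mem_of_rPerpList S.thick (fun _ h => h) (thick_isThickOf U)
      (fun a ha => ⟨(hl a ha).1, (hl a ha).2, hlT _ (thick_isThickOf U) .base a ha⟩) hl'
      (fun Y hY => h Y ((hlU Y).1 hY)) hX
  · exfalso
    obtain ⟨N, hN⟩ := S.bdd hTE hU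
    have hUV : Orth U (E⟦-|N|⟧) := (orth_shift_right _).2 hUE
    have hVU : ∀ i : ℤ, 0 < i → Van (E⟦-|N|⟧) U i := fun i hi =>
      (van_shift_left _ _).2 (hN _ (by grind))
    have hVV := (hE.shift (-|N|))
    refine hVV.ne (isZero_of_van ((hmax _ (S.thick.shift hTE _) hVV.ind.indec fun i hi =>
      van_biprod_left (van_biprod_right (hUU i hi) (hUV i))
        (van_biprod_right (hVU i hi) (hVV.van i hi.ne'))).van (hUV 0)))

/-- The fiber of a right approximation by powers of `U`. -/
lemma exists_approx_fiber {U W : D} (hTU : T₀ U) (hTW : T₀ W) (hUU : ∀ i : ℤ, 0 < i → Van U U i)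
    (hUW : ∀ i : ℤ, 0 < i → Van U W i) :
    ∃ (A W' : D) (f : W' ⟶ A) (g : A ⟶ W) (h : W ⟶ W'⟦(1 : ℤ)⟧),
      Triangle.mk f g h ∈ distTriang D ∧ Pow U A ∧ T₀ W' ∧ ∀ i : ℤ, 0 < i → Van U W' i := by
  obtain ⟨A, g, hA, hg⟩ := exists_right_approx R (S.fin hTU hTW)
  obtain ⟨W', f, h, hT⟩ := exists_fiber g
  refine ⟨A, W', f, g, h, hT, hA, S.thick.ext₁ hT (hA.mem S.thick.zero hTU S.thick.biprod) hTW,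
    fun i hi => ?_⟩
  obtain rfl | hi := (show 1 ≤ i from hi).eq_or_lt
  · intro x
    obtain ⟨y, rfl⟩ := tri_to₁ hT x (hA.van_right (hUU 1 hi) _)
    obtain ⟨w, rfl⟩ := hg y
    rw [Category.assoc, tri_zero₂₃ hT, comp_zero]
  · exact van_tri₁ hT (hUW _ (by omega)) (hA.van_right (hUU i (by omega)))

lemma addOf_of_generates {U V : D} (hTU : T₀ U) (hTV : T₀ V) (hUU : ∀ i : ℤ, 0 < i → Van U U i)
    (hUV : ∀ i : ℤ, 0 < i → Van U V i) (hVU : ∀ i : ℤ, 0 < i → Van V U i)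
    (hV : IsThickOf D U V) : AddOf U V := by
  obtain ⟨N, hN⟩ := thick_isThickOf_min (thick_van_uniform U) ⟨1, fun W hW n hn => hW n hn⟩ hV
  have key : ∀ (m : ℕ) (W : D), T₀ W → (∀ i : ℤ, 0 < i → Van U W i) →
      ∀ j : ℤ, 0 < j → N ≤ j + m → Van V W j := by
    intro m
    induction m with
    | zero => exact fun W _ hW j _ hj => hN W hW j (by simpa using hj)
    | succ m ih =>
      intro W hTW hW j hj hjm
      obtain ⟨A, W', f, g, h, hT, hA, hTW', hW'⟩ := S.exists_approx_fiber hTU hTW hUU hW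
      exact van_tri₃ hT (hA.van_right (hVU j hj)) (ih W' hTW' hW' _ (by omega)
          (by push_cast at hjm; omega))
  obtain ⟨A, W', f, g, h, hT, hA, hTW', hW'⟩ := S.exists_approx_fiber hTU hTV hUU hUV
  obtain ⟨i, hi⟩ := tri_to₃ hT (𝟙 V) (key N.toNat W' hTW' hW' 1 one_pos (by omega) _)
  obtain ⟨C, e, -⟩ := exists_compl i g hi.symm
  exact .summandLeft (.ofIso e (hA.mem (.zero _) .base .biprod))

end Setup

end Thick

/-- Lemma 8.5. Let `Q` be a finite acyclic quiver and
`B = kQ` its (finite dimensional, hereditary) path algebra, and let `U` be a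
basic partial silting object in `D_fd(B) = per B`. Then `U` is a maximal
partial silting object if and only if `U` generates `per B`, i.e.
`thick U = per B`.

`B` and its derived category are modelled abstractly: `D` is the derived
category `D(B)`, `B` is concentrated in degree `0` (no self-extensions in
nonzero degrees) with `H^0 B = Hom(B, B)` finite dimensional; `mod` is the
heart `mod B ⊆ D_fd(B)`, hereditary (no `Ext^i` for `i < 0` or `i ≥ 2`) and,
`B` being hereditary, every object of `per B` decomposes as a finite direct
sum of shifts of modules. -/
theorem maximal_partial_silting_iff_generates
    (k : Type u) [Field k]
    (D : Type u) [Category.{v} D] [Preadditive D] [CategoryTheory.Linear k D]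
    [HasZeroObject D] [HasShift D ℤ] [∀ n : ℤ, (shiftFunctor D n).Additive]
    [Pretriangulated D] [HasBinaryBiproducts D] [HasFiniteBiproducts D]
    -- the finite acyclic quiver `Q`
    (Q : GradedQuiver.{u}) (hQdeg : ∀ a : Q.Arr, Q.deg a = 0)
    (hQac : Q.Acyclic)
    -- `B = kQ`, as an object of its derived category `D = D(B)`
    (B : D)
    -- `B` is a finite dimensional algebra concentrated in degree `0`
    (hB0 : ∀ i : ℤ, i ≠ 0 → ∀ f : B ⟶ B⟦i⟧, f = 0)
    (hBfd : FiniteDimensional k (B ⟶ B))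
    -- the heart `mod B` of the standard t-structure on `D_fd(B) = per B`
    (mod : Set D) (hBmod : B ∈ mod)
    -- `B` is hereditary: no extensions between modules in degrees `< 0` or `≥ 2`
    (hered : ∀ X ∈ mod, ∀ Y ∈ mod, ∀ i : ℤ, (i < 0 ∨ 2 ≤ i) →
      ∀ f : X ⟶ Y⟦i⟧, f = 0)
    -- and every perfect complex splits into shifts of modules
    (split : ∀ X : D, IsThickOf D B X →
      ∃ (n : ℕ) (f : Fin n → D) (s : Fin n → ℤ),
        (∀ j, f j ∈ mod) ∧ Nonempty (X ≅ ⨁ fun j => (f j)⟦s j⟧))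
    -- `U` is a basic partial silting object of `D_fd(B) = per B`
    (U : D) (hU : IsThickOf D B U)
    (hUps : ∀ i : ℤ, 0 < i → ∀ f : U ⟶ U⟦i⟧, f = 0)
    (hUbasic : IsBasic U) :
    -- `U` is maximal partial silting ⟺ `U` generates `per B`
    ((∀ V : D, IsThickOf D B V → Indec V →
        (∀ i : ℤ, 0 < i → ∀ f : (U ⊞ V) ⟶ (U ⊞ V)⟦i⟧, f = 0) →
        AddOf U V)
      ↔ (∀ X : D, IsThickOf D B X → IsThickOf D U X)) := by
  have S := setup_of_split hB0 hBfd hered split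
  refine ⟨fun hmax X hX => S.generates_of_maximal .base hB0 (fun Y hY h => isZero_of_orth
    (thick_isThickOf_min (thick_orth_left Y) h hY)) hU hUps hmax hX, fun hgen V hV _ hUV => ?_⟩
  have hUV' : ∀ i : ℤ, 0 < i → Van (U ⊞ V) (U ⊞ V) i := hUV
  exact S.addOf_of_generates hU hV hUps
    (fun i hi => ((hUV' i hi).of_retract_left biprod.inl biprod.fst (by simp)).of_retract_right
      biprod.inr biprod.snd (by simp))
    (fun i hi => ((hUV' i hi).of_retract_left biprod.inr biprod.snd (by simp)).of_retract_right
      biprod.inl biprod.fst (by simp)) (hgen V hV)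

end HigherCluster
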